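/- For K either of the maximal compact open subgroups K_0, K_1 of G, both universal quotients (ind_K^G st)/(T) and (ind_K^G 1)/(T+1) are not irreducible representations of G, where 1 is the trivial weight and st the Steinberg weight of K. -/

import Mathlib

open scoped Classical

noncomputable section

namespace U21

/-- The arithmetic setting: `E` is the unramified quadratic extension of a non-archimedean
local field `F` of odd residue characteristic `p`, with residue field of `F` of cardinality
`q = p ^ fdeg`.  The field `E` is encoded through its valuation subring `O = o_E`, a
uniformizer `ϖ`, the maximal ideal `mI` (so that `p_E^k` is `ϖ ^ k * O`), and the nontrivial
`F`-automorphism `conj` of `E` (which induces the `q`-power Frobenius on the residue field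
of `E`, of cardinality `q ^ 2`). -/
structure Setting where
  p : ℕ
  q : ℕ
  fdeg : ℕ
  hp : p.Prime
  hodd : p ≠ 2
  hfdeg : 0 < fdeg
  hq : q = p ^ fdeg
  E : Type
  [fieldE : Field E]
  conj : E →+* E
  conj_invol : ∀ x, conj (conj x) = x
  conj_ne : conj ≠ RingHom.id E
  O : Subring E
  val_ring : ∀ x : E, x ≠ 0 → x ∈ O ∨ x⁻¹ ∈ O
  conj_O : ∀ x, x ∈ O → conj x ∈ O
  ϖ : E
  unif_mem : ϖ ∈ O
  unif_ne : ϖ ≠ 0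
  unif_conj : conj ϖ = ϖ
  unif_not_unit : ¬ IsUnit (⟨ϖ, unif_mem⟩ : O)
  disc : ∀ x : E, x ≠ 0 → ∃ (n : ℤ) (u : Oˣ), x = (u : O) * ϖ ^ n
  mI : Ideal O
  hmI : ∀ x : O, x ∈ mI ↔ ∃ y ∈ O, (x : E) = ϖ * y
  [fin_res : Fintype (O ⧸ mI)]
  card_res : Fintype.card (O ⧸ mI) = q ^ 2
  res_frob : ∀ x : O, Ideal.Quotient.mk mI ⟨conj x, conj_O x x.2⟩ = (Ideal.Quotient.mk mI x) ^ q
  complete : ∀ a : ℕ → E,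
    (∀ k : ℕ, ∃ N, ∀ m ≥ N, ∀ n ≥ N, ∃ w ∈ O, a m - a n = ϖ ^ k * w) →
    ∃ L : E, ∀ k : ℕ, ∃ N, ∀ n ≥ N, ∃ w ∈ O, a n - L = ϖ ^ k * w

attribute [instance] Setting.fieldE Setting.fin_res

namespace Setting

variable (S : Setting)

/-- 3×3 matrices over `E`. -/
abbrev M3 := Matrix (Fin 3) (Fin 3) S.E

/-- The antidiagonal matrix `β` of the Hermitian form. -/
def betaM : S.M3 := !![0,0,1;0,1,0;1,0,0]

/-- The fractional ideal `p_E ^ k ⊆ E` (for `k : ℤ`). -/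
def pE (k : ℤ) : Set S.E := {z | ∃ w ∈ S.O, z = S.ϖ ^ k * w}

/-- The unramified unitary group `G = U(2,1)(E/F)`, as a subgroup of `GL₃(E)`:
`g ∈ G` iff `g.transpose * β * conj g = β`. -/
def Gsub : Subgroup (Matrix.GeneralLinearGroup (Fin 3) S.E) where
  carrier := {g | ((g : S.M3)).transpose * S.betaM * ((g : S.M3).map S.conj) = S.betaM}
  one_mem' := by
    simp [Matrix.map_one (⇑S.conj) (map_zero S.conj) (map_one S.conj)]
  mul_mem' := by
    intro a b ha hb
    simp only [Set.mem_setOf_eq, Units.val_mul, Matrix.transpose_mul, Matrix.map_mul] at ha hb ⊢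
    calc ((b : S.M3)).transpose * ((a : S.M3)).transpose * S.betaM * ((a : S.M3).map S.conj * (b : S.M3).map S.conj)
        = ((b : S.M3)).transpose * (((a : S.M3)).transpose * S.betaM * (a : S.M3).map S.conj) * ((b : S.M3).map S.conj) := by
          simp only [mul_assoc]
      _ = S.betaM := by rw [ha]; exact hb
  inv_mem' := by
    intro a ha
    simp only [Set.mem_setOf_eq] at ha ⊢
    have hA : IsUnit ((a : S.M3)) := a.isUnit
    have hdet : IsUnit ((a : S.M3)).det := (Matrix.isUnit_iff_isUnit_det _).mp hA
    have hAc : IsUnit (((a : S.M3)).map ⇑S.conj) := by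
      rw [← RingHom.mapMatrix_apply]; exact hA.map _
    have hdetc : IsUnit ((((a : S.M3)).map ⇑S.conj).det) := (Matrix.isUnit_iff_isUnit_det _).mp hAc
    have hdetT : IsUnit ((((a : S.M3)).transpose).det) := by rw [Matrix.det_transpose]; exact hdet
    have hmapinv : ((a : S.M3)⁻¹).map ⇑S.conj = (((a : S.M3)).map ⇑S.conj)⁻¹ := by
      symm
      apply Matrix.inv_eq_left_inv
      rw [← Matrix.map_mul, Matrix.nonsing_inv_mul _ hdet,
        Matrix.map_one (⇑S.conj) (map_zero S.conj) (map_one S.conj)]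
    rw [Matrix.coe_units_inv, Matrix.transpose_nonsing_inv, hmapinv]
    conv_lhs => rw [← ha]
    calc (((a:S.M3)).transpose)⁻¹ * (((a:S.M3)).transpose * S.betaM * ((a:S.M3)).map ⇑S.conj) * (((a:S.M3)).map ⇑S.conj)⁻¹
        = (((a:S.M3)).transpose)⁻¹ * ((a:S.M3)).transpose * S.betaM *
            (((a:S.M3)).map ⇑S.conj * (((a:S.M3)).map ⇑S.conj)⁻¹) := by simp only [mul_assoc]
      _ = S.betaM := by
          rw [Matrix.nonsing_inv_mul _ hdetT, Matrix.mul_nonsing_inv _ hdetc, one_mul, mul_one]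

/-- The group `G = U(2,1)(E/F)`. -/
abbrev GG := ↥S.Gsub

/-- The matrix of an element of `G`. -/
def mat (g : S.GG) : S.M3 := ((g : Matrix.GeneralLinearGroup (Fin 3) S.E) : S.M3)

/-- The upper unipotent matrix `n(x,y)`. -/
def nM (x y : S.E) : S.M3 := !![1, x, y; 0, 1, -S.conj x; 0, 0, 1]

/-- The lower unipotent matrix `n'(x,y)`. -/
def n'M (x y : S.E) : S.M3 := !![1, 0, 0; x, 1, 0; y, -S.conj x, 1]

/-- The diagonal matrix `h(x) = diag(x, -x̄x⁻¹, x̄⁻¹)`. -/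
def hM (x : S.E) : S.M3 := !![x, 0, 0; 0, -S.conj x * x⁻¹, 0; 0, 0, (S.conj x)⁻¹]

/-- The subgroup `N` of `G` (unipotent radical of the upper triangular Borel), as a set. -/
def Nset : Set S.GG := {g | ∃ x y : S.E, x * S.conj x + y + S.conj y = 0 ∧ S.mat g = S.nM x y}

/-- The subgroup `N_k = {n(x,y) : y ∈ p_E^k}`, as a set. -/
def Nk (k : ℤ) : Set S.GG :=
  {g | ∃ x y : S.E, x * S.conj x + y + S.conj y = 0 ∧ y ∈ S.pE k ∧ S.mat g = S.nM x y}

/-- The subgroup `N'` of `G`, as a set. -/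
def N'set : Set S.GG := {g | ∃ x y : S.E, x * S.conj x + y + S.conj y = 0 ∧ S.mat g = S.n'M x y}

/-- The subgroup `N'_k = {n'(x,y) : y ∈ p_E^k}`, as a set. -/
def N'k (k : ℤ) : Set S.GG :=
  {g | ∃ x y : S.E, x * S.conj x + y + S.conj y = 0 ∧ y ∈ S.pE k ∧ S.mat g = S.n'M x y}

/-- The diagonal subgroup `H` of `G`, as a set. -/
def Hset : Set S.GG := {g | ∃ a b c : S.E, S.mat g = !![a,0,0;0,b,0;0,0,c]}

/-- The hyperspecial maximal compact subgroup `K₀ = G ∩ GL₃(o_E)`, as a set. -/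
def K0set : Set S.GG := {g | ∀ i j, S.mat g i j ∈ S.O}

/-- The special (non-hyperspecial) maximal compact subgroup `K₁`, as a set. -/
def K1set : Set S.GG :=
  {g | S.mat g 0 0 ∈ S.O ∧ S.mat g 0 1 ∈ S.O ∧ S.mat g 0 2 ∈ S.pE (-1) ∧
       S.mat g 1 0 ∈ S.pE 1 ∧ S.mat g 1 1 ∈ S.O ∧ S.mat g 1 2 ∈ S.O ∧
       S.mat g 2 0 ∈ S.pE 1 ∧ S.mat g 2 1 ∈ S.pE 1 ∧ S.mat g 2 2 ∈ S.O}

/-- The Iwahori subgroup `I_{K₀}` (preimage of the Borel of `Γ_{K₀}`), as a set. -/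
def IK0 : Set S.GG :=
  {g | g ∈ S.K0set ∧ S.mat g 1 0 ∈ S.pE 1 ∧ S.mat g 2 0 ∈ S.pE 1 ∧ S.mat g 2 1 ∈ S.pE 1}

/-- The pro-p Iwahori subgroup `I_{1,K₀}`, as a set. -/
def I1K0 : Set S.GG :=
  {g | g ∈ S.IK0 ∧ S.mat g 0 0 - 1 ∈ S.pE 1 ∧ S.mat g 1 1 - 1 ∈ S.pE 1 ∧ S.mat g 2 2 - 1 ∈ S.pE 1}

/-- The opposite pro-p Iwahori subgroup `I'_{1,K₀}`, as a set. -/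
def I1'K0 : Set S.GG :=
  {g | g ∈ S.K0set ∧ S.mat g 0 1 ∈ S.pE 1 ∧ S.mat g 0 2 ∈ S.pE 1 ∧ S.mat g 1 2 ∈ S.pE 1 ∧
       S.mat g 0 0 - 1 ∈ S.pE 1 ∧ S.mat g 1 1 - 1 ∈ S.pE 1 ∧ S.mat g 2 2 - 1 ∈ S.pE 1}

/-- The maximal normal pro-p subgroup `K₀¹` of `K₀` (principal congruence subgroup), as a set. -/
def Kone0 : Set S.GG := {g | ∀ i j, S.mat g i j - (1 : S.M3) i j ∈ S.pE 1}

/-- The Iwahori subgroup `I_{K₁}`, as a set. -/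
def IK1 : Set S.GG := {g | g ∈ S.K1set ∧ S.mat g 2 0 ∈ S.pE 2}

/-- The pro-p Iwahori subgroup `I_{1,K₁}`, as a set. -/
def I1K1 : Set S.GG :=
  {g | g ∈ S.IK1 ∧ S.mat g 0 0 - 1 ∈ S.pE 1 ∧ S.mat g 1 1 - 1 ∈ S.pE 1 ∧ S.mat g 2 2 - 1 ∈ S.pE 1}

/-- The opposite pro-p Iwahori subgroup `I'_{1,K₁}`, as a set. -/
def I1'K1 : Set S.GG :=
  {g | g ∈ S.K1set ∧ S.mat g 0 2 ∈ S.O ∧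
       S.mat g 0 0 - 1 ∈ S.pE 1 ∧ S.mat g 1 1 - 1 ∈ S.pE 1 ∧ S.mat g 2 2 - 1 ∈ S.pE 1}

/-- The maximal normal pro-p subgroup `K₁¹` of `K₁`, as a set. -/
def Kone1 : Set S.GG :=
  {g | g ∈ S.K1set ∧ S.mat g 0 2 ∈ S.O ∧ S.mat g 2 0 ∈ S.pE 2 ∧
       S.mat g 0 0 - 1 ∈ S.pE 1 ∧ S.mat g 1 1 - 1 ∈ S.pE 1 ∧ S.mat g 2 2 - 1 ∈ S.pE 1}

/-- The congruence subgroup of level `n` (used to express smoothness), as a set. -/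
def cong (n : ℕ) : Set S.GG := {g | ∀ i j, S.mat g i j - (1 : S.M3) i j ∈ S.pE n}

def alphaM : S.M3 := !![S.ϖ⁻¹, 0, 0; 0, 1, 0; 0, 0, S.ϖ]

def alphaMinv : S.M3 := !![S.ϖ, 0, 0; 0, 1, 0; 0, 0, S.ϖ⁻¹]

lemma alpha_mul_inv : S.alphaM * S.alphaMinv = 1 := by
  ext i j
  fin_cases i <;> fin_cases j <;>
    simp [alphaM, alphaMinv, Matrix.mul_apply, Fin.sum_univ_three, Matrix.one_apply,
      Matrix.vecHead, Matrix.vecTail, inv_mul_cancel₀ S.unif_ne, mul_inv_cancel₀ S.unif_ne]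

lemma alpha_inv_mul : S.alphaMinv * S.alphaM = 1 := by
  ext i j
  fin_cases i <;> fin_cases j <;>
    simp [alphaM, alphaMinv, Matrix.mul_apply, Fin.sum_univ_three, Matrix.one_apply,
      Matrix.vecHead, Matrix.vecTail, inv_mul_cancel₀ S.unif_ne, mul_inv_cancel₀ S.unif_ne]

def alphaU : Matrix.GeneralLinearGroup (Fin 3) S.E :=
  ⟨S.alphaM, S.alphaMinv, S.alpha_mul_inv, S.alpha_inv_mul⟩

lemma alphaU_mem : S.alphaU ∈ S.Gsub := by
  show ((S.alphaU : S.M3)).transpose * S.betaM * ((S.alphaU : S.M3).map S.conj) = S.betaM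
  have : (S.alphaU : S.M3) = S.alphaM := rfl
  rw [this]
  ext i j
  fin_cases i <;> fin_cases j <;>
    simp [alphaM, betaM, Matrix.mul_apply, Fin.sum_univ_three, Matrix.map_apply,
      Matrix.transpose_apply, Matrix.vecHead, Matrix.vecTail, map_inv₀, S.unif_conj,
      inv_mul_cancel₀ S.unif_ne, mul_inv_cancel₀ S.unif_ne]

/-- The element `α = diag(ϖ⁻¹, 1, ϖ)` of `G`. -/
def alphaE : S.GG := ⟨S.alphaU, S.alphaU_mem⟩

lemma beta_mul_beta : S.betaM * S.betaM = 1 := by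
  ext i j
  fin_cases i <;> fin_cases j <;>
    simp [betaM, Matrix.mul_apply, Fin.sum_univ_three, Matrix.one_apply,
      Matrix.vecHead, Matrix.vecTail]

def betaU : Matrix.GeneralLinearGroup (Fin 3) S.E :=
  ⟨S.betaM, S.betaM, S.beta_mul_beta, S.beta_mul_beta⟩

lemma betaU_mem : S.betaU ∈ S.Gsub := by
  show ((S.betaU : S.M3)).transpose * S.betaM * ((S.betaU : S.M3).map S.conj) = S.betaM
  have : (S.betaU : S.M3) = S.betaM := rfl
  rw [this]
  ext i j
  fin_cases i <;> fin_cases j <;>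
    simp [betaM, Matrix.mul_apply, Fin.sum_univ_three, Matrix.map_apply, Matrix.transpose_apply,
      Matrix.vecHead, Matrix.vecTail]

/-- The element `β` of `G`. -/
def betaE : S.GG := ⟨S.betaU, S.betaU_mem⟩

/-- The element `β' = β * α⁻¹` of `G`. -/
def betaPr : S.GG := S.betaE * S.alphaE⁻¹

/-- A finite set `U` is a set of representatives for the cosets `A/B`. -/
def IsReps (A B : Set S.GG) (U : Finset S.GG) : Prop :=
  (↑U : Set S.GG) ⊆ A ∧ ∀ a ∈ A, ∃! u, u ∈ U ∧ a⁻¹ * u ∈ B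

/-- The residue field `k_E` of `E`. -/
abbrev kE := S.O ⧸ S.mI

/-- The residue map `o_E → k_E`. -/
def resmap : S.O →+* S.kE := Ideal.Quotient.mk S.mI

/-- The group `L_{q³} = {(x,t) ∈ k_E² : x x̄ + t + t̄ = 0}` (where `x̄ = x^q`). -/
def Lbig : Set (S.kE × S.kE) := {z | z.1 * z.1 ^ S.q + z.2 + z.2 ^ S.q = 0}

/-- The group `L_q = {(0,t) ∈ k_E² : t + t̄ = 0}`. -/
def Lsmall : Set (S.kE × S.kE) := {z | z.1 = 0 ∧ z.2 + z.2 ^ S.q = 0}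

/-- `L_{q^t}` for `t ∈ {1,3}`. -/
def Lof (t : ℕ) : Set (S.kE × S.kE) := if t = 3 then S.Lbig else S.Lsmall

end Setting

/-- A choice of one of the two maximal compact open subgroups `K ∈ {K₀, K₁}` of `G`,
together with its maximal normal pro-p subgroup `K¹`, the (pro-p) Iwahori subgroups
`I_K ⊇ I_{1,K}`, the opposite pro-p Iwahori `I'_{1,K}`, the element
`β_K ∈ K ∩ {β, β'}`, and the integers `n_K, m_K, t_K`. -/
structure Chamber (S : Setting) where
  K : Subgroup S.GG
  KoneS : Set S.GG
  IK : Set S.GG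
  I1 : Set S.GG
  I1' : Set S.GG
  βK : S.GG
  nK : ℤ
  mK : ℤ
  tK : ℕ
  cases :
    ((K : Set S.GG) = S.K0set ∧ KoneS = S.Kone0 ∧ IK = S.IK0 ∧ I1 = S.I1K0 ∧ I1' = S.I1'K0 ∧
      βK = S.betaE ∧ nK = 0 ∧ mK = 1 ∧ tK = 3) ∨
    ((K : Set S.GG) = S.K1set ∧ KoneS = S.Kone1 ∧ IK = S.IK1 ∧ I1 = S.I1K1 ∧ I1' = S.I1'K1 ∧
      βK = S.betaPr ∧ nK = -1 ∧ mK = 2 ∧ tK = 1)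

namespace Chamber

variable {S : Setting} (C : Chamber S)

/-- `H₀ = H ∩ I_K`. -/
def H0 : Set S.GG := S.Hset ∩ C.IK

/-- `H₁ = H ∩ I_{1,K}`. -/
def H1 : Set S.GG := S.Hset ∩ C.I1

end Chamber

section RepTheory

variable {S : Setting} (C : Chamber S)
variable (𝔽 : Type) [Field 𝔽]

section Generic

variable {G₀ : Type} [Monoid G₀] {V : Type} [AddCommGroup V] [Module 𝔽 V]

/-- A submodule is invariant under a representation. -/
def Invt (ρ : Representation 𝔽 G₀ V) (Ssub : Submodule 𝔽 V) : Prop :=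
  ∀ g v, v ∈ Ssub → ρ g v ∈ Ssub

/-- The subrepresentation generated by a vector (the span of its orbit). -/
def orbitSpan (ρ : Representation 𝔽 G₀ V) (v : V) : Submodule 𝔽 V :=
  Submodule.span 𝔽 {w | ∃ g, w = ρ g v}

/-- The subrepresentation generated by a vector under a subset `A` of the group. -/
def orbitSpanOn (ρ : Representation 𝔽 G₀ V) (A : Set G₀) (v : V) : Submodule 𝔽 V :=
  Submodule.span 𝔽 {w | ∃ g ∈ A, w = ρ g v}

/-- The quotient of a representation by an invariant submodule `N` is irreducible:
equivalently (by the lattice correspondence), `N ≠ ⊤` and any invariant submodule lying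
between `N` and `⊤` equals `N` or `⊤`. -/
def QuotientIrreducible (ρ : Representation 𝔽 G₀ V) (N : Submodule 𝔽 V) : Prop :=
  N ≠ ⊤ ∧ ∀ Ssub : Submodule 𝔽 V, Invt 𝔽 ρ Ssub → N ≤ Ssub → Ssub = N ∨ Ssub = ⊤

/-- The submodule of vectors invariant under all elements of the subset `A`. -/
def invariantsOn (ρ : Representation 𝔽 G₀ V) (A : Set G₀) : Submodule 𝔽 V where
  carrier := {v | ∀ g ∈ A, ρ g v = v}
  add_mem' := by
    intro a b ha hb g hg
    rw [map_add, ha g hg, hb g hg]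
  zero_mem' := by
    intro g hg
    rw [map_zero]
  smul_mem' := by
    intro c a ha g hg
    rw [map_smul, ha g hg]

/-- The space `Hom_G(ρ₁, ρ₂)` of equivariant linear maps, as a submodule of the linear maps. -/
def EquivHomSub {V₂ : Type} [AddCommGroup V₂] [Module 𝔽 V₂]
    (ρ₁ : Representation 𝔽 G₀ V) (ρ₂ : Representation 𝔽 G₀ V₂) :
    Submodule 𝔽 (V →ₗ[𝔽] V₂) where
  carrier := {φ | ∀ g x, φ (ρ₁ g x) = ρ₂ g (φ x)}
  add_mem' := by
    intro a b ha hb g x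
    simp only [LinearMap.add_apply, ha g x, hb g x, map_add]
  zero_mem' := by
    intro g x
    simp only [LinearMap.zero_apply, map_zero]
  smul_mem' := by
    intro c a ha g x
    simp only [LinearMap.smul_apply, ha g x, map_smul]

end Generic

section Weight

variable (W : Type) [AddCommGroup W] [Module 𝔽 W]
variable (σ : Representation 𝔽 ↥C.K W)

/-- Extension of `σ` to all of `G` (by `1` outside `K`); used to avoid coercion issues. -/
def sigma' : S.GG → Module.End 𝔽 W := fun g => if h : g ∈ C.K then σ ⟨g, h⟩ else 1

/-- `σ` is a weight of `K`: an irreducible smooth representation of `K` over `𝔽`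
factoring through `Γ_K = K / K¹` (automatically finite dimensional). -/
def IsWeight : Prop :=
  Nontrivial W ∧ FiniteDimensional 𝔽 W ∧
  (∀ Ssub : Submodule 𝔽 W, (∀ (k : ↥C.K) (w : W), w ∈ Ssub → σ k w ∈ Ssub) → Ssub = ⊥ ∨ Ssub = ⊤) ∧
  (∀ (g : S.GG) (hg : g ∈ C.K), g ∈ C.KoneS → σ ⟨g, hg⟩ = LinearMap.id)

/-- `σ` is one dimensional of the form `χ ∘ det`. -/
def IsDetWeight : Prop :=
  Module.finrank 𝔽 W = 1 ∧
  ∃ c : S.E → 𝔽, ∀ (g : S.GG) (hg : g ∈ C.K) (w : W), σ ⟨g, hg⟩ w = c ((S.mat g).det) • w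

/-- `j_σ : σ → σ` is the composition of the coinvariant projection `σ → σ_{I'_{1,K}}`
with the inverse of the natural isomorphism `σ^{I_{1,K}} ≅ σ_{I'_{1,K}}`:
it restricts to the identity on `σ^{I_{1,K}}` and kills the augmentation part of
`σ` with respect to `I'_{1,K}`. -/
def IsJ (jσ : W →ₗ[𝔽] W) : Prop :=
  (∀ w : W, (∀ g ∈ C.I1, sigma' C 𝔽 W σ g w = w) → jσ w = w) ∧
  (∀ (w : W) (g : S.GG), g ∈ C.I1' → jσ (sigma' C 𝔽 W σ g w - w) = 0)

/-- The defining conditions of the compact induction `ind_K^G σ`: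
`K`-equivariance on the left and compact support (finitely many cosets `K g`). -/
def IndCarrier : Set (S.GG → W) :=
  {f | (∀ (k : S.GG) (hk : k ∈ C.K) (g : S.GG), f (k * g) = σ ⟨k, hk⟩ (f g)) ∧
       ∃ s : Finset S.GG, ∀ g : S.GG, f g ≠ 0 → ∃ k ∈ C.K, ∃ t ∈ s, g = k * t}

/-- The compact induction `ind_K^G σ`, as a submodule of `G → W`. -/
def IndSub : Submodule 𝔽 (S.GG → W) where
  carrier := IndCarrier C 𝔽 W σ
  add_mem' := by
    rintro f g ⟨hf1, sf, hf2⟩ ⟨hg1, sg, hg2⟩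
    refine ⟨fun k hk x => by simp [hf1 k hk x, hg1 k hk x], sf ∪ sg, fun x hx => ?_⟩
    by_cases h : f x ≠ 0
    · obtain ⟨k, hk, t, ht, rfl⟩ := hf2 x h
      exact ⟨k, hk, t, Finset.mem_union_left _ ht, rfl⟩
    · push_neg at h
      have hgx : g x ≠ 0 := by
        intro h0
        apply hx
        simp [Pi.add_apply, h, h0]
      obtain ⟨k, hk, t, ht, rfl⟩ := hg2 x hgx
      exact ⟨k, hk, t, Finset.mem_union_right _ ht, rfl⟩
  zero_mem' := ⟨fun k hk g => by simp, ∅, fun g hg => absurd rfl hg⟩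
  smul_mem' := by
    rintro c f ⟨hf1, sf, hf2⟩
    refine ⟨fun k hk g => by simp [hf1 k hk g], sf, fun x hx => ?_⟩
    refine hf2 x ?_
    intro h0
    apply hx
    simp [h0]

lemma indAct_mem (g : S.GG) {f : S.GG → W} (hf : f ∈ IndCarrier C 𝔽 W σ) :
    (fun x => f (x * g)) ∈ IndCarrier C 𝔽 W σ := by
  obtain ⟨h1, s, h2⟩ := hf
  refine ⟨fun k hk x => ?_, s.image (· * g⁻¹), ?_⟩
  · show f (k * x * g) = _
    rw [mul_assoc]
    exact h1 k hk (x * g)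
  intro x hx
  obtain ⟨k, hk, t, ht, hxg⟩ := h2 (x * g) hx
  refine ⟨k, hk, t * g⁻¹, Finset.mem_image_of_mem _ ht, ?_⟩
  rw [← mul_assoc, ← hxg, mul_assoc, mul_inv_cancel, mul_one]

/-- The representation of `G` on `ind_K^G σ` by right translation. -/
def indRep : Representation 𝔽 S.GG ↥(IndSub C 𝔽 W σ) where
  toFun g :=
    { toFun := fun f => ⟨fun x => (f : S.GG → W) (x * g), indAct_mem C 𝔽 W σ g f.2⟩
      map_add' := fun f1 f2 => Subtype.ext (funext fun x => rfl)
      map_smul' := fun c f => Subtype.ext (funext fun x => rfl) }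
  map_one' := LinearMap.ext fun f => Subtype.ext (funext fun x => by simp [mul_one])
  map_mul' g h := LinearMap.ext fun f => Subtype.ext (funext fun x => by simp [mul_assoc])

/-- The function `[g, v] ∈ ind_K^G σ`: supported on `K g⁻¹`, with value `v` at `g⁻¹`. -/
def stdFn (g : S.GG) (v : W) : S.GG → W :=
  fun x => if h : x * g ∈ C.K then σ ⟨x * g, h⟩ v else 0

/-- The characterization of the family `f_n` (`n ∈ ℤ`) of `I_{1,K}`-invariant elements of
`ind_K^G σ`: `f_n` is supported on `K α⁻ⁿ I_{1,K}` and has value at `α⁻ⁿ` equal to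
`σ(β_K) v₀` for `n > 0` and `v₀` for `n ≤ 0`, where `v₀` is a fixed nonzero vector of
`σ^{I_{1,K}}`. -/
def IsFFamily (v0 : W) (ff : ℤ → ↥(IndSub C 𝔽 W σ)) : Prop :=
  v0 ≠ 0 ∧ (∀ g ∈ C.I1, sigma' C 𝔽 W σ g v0 = v0) ∧
  (∀ (n : ℤ) (g : S.GG), g ∈ C.I1 → indRep C 𝔽 W σ g (ff n) = ff n) ∧
  (∀ (n : ℤ) (x : S.GG), (ff n : S.GG → W) x ≠ 0 →
    ∃ k ∈ C.K, ∃ i ∈ C.I1, x = k * S.alphaE ^ (-n) * i) ∧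
  (∀ n : ℤ, 0 < n → (ff n : S.GG → W) (S.alphaE ^ (-n)) = sigma' C 𝔽 W σ C.βK v0) ∧
  (∀ n : ℤ, n ≤ 0 → (ff n : S.GG → W) (S.alphaE ^ (-n)) = v0)

/-- The characterization of the Hecke operator `T ∈ End_G(ind_K^G σ)`:
it is `G`-equivariant and satisfies
`T [1, v] = ∑_{u ∈ N_{n_K}/N_{n_K+2}} [u α⁻¹, j_σ σ(u⁻¹) v]
  + ∑_{u ∈ N_{n_K+1}/N_{n_K+2}} [β_K u α⁻¹, j_σ σ(β_K) v]`. -/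
def IsHeckeT (jσ : W →ₗ[𝔽] W) (T : Module.End 𝔽 ↥(IndSub C 𝔽 W σ)) : Prop :=
  (∀ (g : S.GG) (x : ↥(IndSub C 𝔽 W σ)),
    T (indRep C 𝔽 W σ g x) = indRep C 𝔽 W σ g (T x)) ∧
  (∀ (v : W) (x : ↥(IndSub C 𝔽 W σ)), (x : S.GG → W) = stdFn C 𝔽 W σ 1 v →
    ∀ (U2 U1 : Finset S.GG),
      S.IsReps (S.Nk C.nK) (S.Nk (C.nK + 2)) U2 →
      S.IsReps (S.Nk (C.nK + 1)) (S.Nk (C.nK + 2)) U1 →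
      ((T x : S.GG → W)) =
        (∑ u ∈ U2, stdFn C 𝔽 W σ (u * S.alphaE⁻¹) (jσ (sigma' C 𝔽 W σ u⁻¹ v))) +
        ∑ u ∈ U1, stdFn C 𝔽 W σ (C.βK * u * S.alphaE⁻¹) (jσ (sigma' C 𝔽 W σ C.βK v)))

/-- The eigencharacter `χ_σ` of `H₀/H₁` afforded by the (one-dimensional) space
`σ^{I_{1,K}}` with chosen basis vector `v₀`. -/
def IsChi (v0 : W) (χ : S.GG → 𝔽) : Prop :=
  (∀ h ∈ C.H0, sigma' C 𝔽 W σ h v0 = χ h • v0)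

/-- Right translation on functions `K → 𝔽` (the action on a (finite) principal series). -/
def PSact (k : ↥C.K) (f : ↥C.K → 𝔽) : ↥C.K → 𝔽 := fun x => f (x * k)

/-- The (inflation to `K` of the) finite principal series `Ind_𝔹^{Γ_K} χ`:
functions on `K`, invariant under right translation by `K¹`, left `I_{1,K}`-invariant and
left `(H₀, χ)`-equivariant. -/
def PSchiSub (χ : S.GG → 𝔽) : Submodule 𝔽 (↥C.K → 𝔽) where
  carrier := {f | (∀ b : ↥C.K, (b : S.GG) ∈ C.I1 → ∀ x, f (b * x) = f x) ∧
                  (∀ h : ↥C.K, (h : S.GG) ∈ C.H0 → ∀ x, f (h * x) = χ (h : S.GG) * f x) ∧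
                  (∀ z : ↥C.K, (z : S.GG) ∈ C.KoneS → ∀ x, f (x * z) = f x)}
  add_mem' := by
    rintro f g ⟨hf1, hf2, hf3⟩ ⟨hg1, hg2, hg3⟩
    exact ⟨fun b hb x => by simp [hf1 b hb x, hg1 b hb x],
           fun h hh x => by simp [hf2 h hh x, hg2 h hh x, mul_add],
           fun z hz x => by simp [hf3 z hz x, hg3 z hz x]⟩
  zero_mem' := ⟨fun b hb x => rfl, fun h hh x => by simp, fun z hz x => rfl⟩
  smul_mem' := by
    rintro c f ⟨hf1, hf2, hf3⟩
    refine ⟨fun b hb x => by simp [hf1 b hb x], fun h hh x => ?_, fun z hz x => by simp [hf3 z hz x]⟩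
    simp only [Pi.smul_apply, hf2 h hh x, smul_eq_mul]
    ring

/-- The principal series `Ind_𝔹^{Γ_K} 1` for the trivial character. -/
def PS1sub : Submodule 𝔽 (↥C.K → 𝔽) := PSchiSub C 𝔽 (fun _ => 1)

/-- `σ_{st}` is the Steinberg weight `st = (Ind_𝔹^{Γ_K} 1)/1`: there is a surjective
`K`-equivariant linear map from `Ind_𝔹^{Γ_K} 1` to it whose kernel is exactly the
constant functions. -/
def IsSteinberg {Wst : Type} [AddCommGroup Wst] [Module 𝔽 Wst]
    (σst : Representation 𝔽 ↥C.K Wst) : Prop :=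
  ∃ φ : ↥(PS1sub C 𝔽) →ₗ[𝔽] Wst, Function.Surjective φ ∧
    (∀ f : ↥(PS1sub C 𝔽), φ f = 0 ↔ ∃ c : 𝔽, (f : ↥C.K → 𝔽) = fun _ => c) ∧
    (∀ (k : ↥C.K) (f f' : ↥(PS1sub C 𝔽)),
      (f' : ↥C.K → 𝔽) = PSact C 𝔽 k (f : ↥C.K → 𝔽) → φ f' = σst k (φ f))

/-- `σ` is isomorphic to a twist of the Steinberg weight by a character. -/
def IsTwistSteinberg : Prop :=
  ∃ (c : ↥C.K →* 𝔽ˣ) (φ : ↥(PS1sub C 𝔽) →ₗ[𝔽] W), Function.Surjective φ ∧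
    (∀ f : ↥(PS1sub C 𝔽), φ f = 0 ↔ ∃ cc : 𝔽, (f : ↥C.K → 𝔽) = fun _ => cc) ∧
    (∀ (k : ↥C.K) (f f' : ↥(PS1sub C 𝔽)),
      (f' : ↥C.K → 𝔽) = PSact C 𝔽 k (f : ↥C.K → 𝔽) →
        φ f' = (c k : 𝔽) • σ k (φ f))

/-- The `K`-subrepresentation of the quotient `(ind_K^G σ) / (range T)` generated by the
image of a vector `v`. -/
def genQuot (T : Module.End 𝔽 ↥(IndSub C 𝔽 W σ)) (v : ↥(IndSub C 𝔽 W σ)) :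
    Submodule 𝔽 (↥(IndSub C 𝔽 W σ) ⧸ LinearMap.range T) :=
  Submodule.span 𝔽 {w | ∃ k ∈ C.K, w = Submodule.Quotient.mk (indRep C 𝔽 W σ k v)}

end Weight

/-- Smoothness of a representation of `G`: every vector is fixed by some congruence
subgroup (equivalently, has open stabilizer). -/
def SmoothRep {V : Type} [AddCommGroup V] [Module 𝔽 V] (ρ : Representation 𝔽 S.GG V) : Prop :=
  ∀ v : V, ∃ n : ℕ, ∀ g ∈ S.cong n, ρ g v = v

end RepTheory

end U21

namespace U21

section Bipartite

variable (𝔽 : Type*) [Field 𝔽] {E X Y : Type*}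

/-- Pullback of finitely supported functions along a map with finite fibres. -/
def pull (a : E → X) (ha : ∀ x, (a ⁻¹' {x}).Finite) : (X →₀ 𝔽) →ₗ[𝔽] (E →₀ 𝔽) where
  toFun f := Finsupp.ofSupportFinite (fun e => f (a e)) (by
    refine (f.support.finite_toSet.biUnion fun x _ => ha x).subset fun e he => ?_
    simpa using he)
  map_add' f g := by ext; rfl
  map_smul' c f := by ext; rfl

variable {𝔽}

lemma pull_apply (a : E → X) (ha : ∀ x, (a ⁻¹' {x}).Finite) (f : X →₀ 𝔽) (e : E) :
    pull 𝔽 a ha f e = f (a e) := rfl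

lemma mapDomain_apply_eq_sum_fiber (a : E → X) (ha : ∀ x, (a ⁻¹' {x}).Finite) (c : E →₀ 𝔽)
    (x : X) : Finsupp.mapDomain a c x = ∑ e ∈ (ha x).toFinset, c e := by
  induction c using Finsupp.induction_linear with
  | zero => simp
  | add f g hf hg => simp [Finsupp.mapDomain_add, hf, hg, Finset.sum_add_distrib]
  | single e r =>
    rw [Finsupp.mapDomain_single]
    simp [Finsupp.single_apply, Finset.sum_ite_eq]

/-- Summation of a function on one part of a bipartite graph over the neighbours of the vertices
of the other part; `E` is the set of edges. -/
def spread (a : E → X) (ha : ∀ x, (a ⁻¹' {x}).Finite) (b : E → Y) :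
    (X →₀ 𝔽) →ₗ[𝔽] (Y →₀ 𝔽) :=
  Finsupp.lmapDomain 𝔽 𝔽 b ∘ₗ pull 𝔽 a ha

lemma spread_apply (a : E → X) (ha : ∀ x, (a ⁻¹' {x}).Finite) (b : E → Y)
    (hb : ∀ y, (b ⁻¹' {y}).Finite) (f : X →₀ 𝔽) (y : Y) :
    spread a ha b f y = ∑ e ∈ (hb y).toFinset, f (a e) :=
  mapDomain_apply_eq_sum_fiber b hb _ y

/-- A bipartite graph with a height function on vertices for which every vertex has at most one
higher neighbour, and at least three edges. -/
structure IsHeight (a : E → X) (b : E → Y) (hX : X → ℤ) (hY : Y → ℤ) : Prop where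
  ne : ∀ e, hX (a e) ≠ hY (b e)
  uniq : ∀ e e', b e = b e' → hY (b e) < hX (a e) → hY (b e') < hX (a e') → e = e'
  uniq' : ∀ e e', a e = a e' → hX (a e) < hY (b e) → hX (a e') < hY (b e') → e = e'
  three : ∀ x, ∃ e₁ e₂ e₃, a e₁ = x ∧ a e₂ = x ∧ a e₃ = x ∧ e₁ ≠ e₂ ∧ e₁ ≠ e₃ ∧ e₂ ≠ e₃

variable {a : E → X} {b : E → Y} {hX : X → ℤ} {hY : Y → ℤ}

lemma IsHeight.exists_two_lower (h : IsHeight a b hX hY) (x : X) :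
    ∃ e₁ e₂, e₁ ≠ e₂ ∧ a e₁ = x ∧ a e₂ = x ∧ hY (b e₁) < hX x ∧ hY (b e₂) < hX x := by
  obtain ⟨e₁, e₂, e₃, h₁, h₂, h₃, h12, h13, h23⟩ := h.three x
  have key : ∀ e e', a e = x → a e' = x → e ≠ e' →
      hY (b e) < hX x ∨ hY (b e') < hX x := by
    intro e e' he he' hne
    by_contra! hc
    refine hne (h.uniq' e e' (he.trans he'.symm) ?_ ?_)
    · exact lt_of_le_of_ne (he ▸ hc.1) (h.ne e)
    · exact lt_of_le_of_ne (he' ▸ hc.2) (h.ne e')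
  rcases key _ _ h₁ h₂ h12 with k₁ | k₁
  · rcases key _ _ h₂ h₃ h23 with k₂ | k₂
    exacts [⟨e₁, e₂, h12, h₁, h₂, k₁, k₂⟩, ⟨e₁, e₃, h13, h₁, h₃, k₁, k₂⟩]
  · rcases key _ _ h₁ h₃ h13 with k₂ | k₂
    exacts [⟨e₁, e₂, h12, h₁, h₂, k₂, k₁⟩, ⟨e₂, e₃, h23, h₂, h₃, k₁, k₂⟩]

/-- The function obtained by summing over neighbours has at least two points in its support. -/
lemma IsHeight.exists_two_support (h : IsHeight a b hX hY) (ha : ∀ x, (a ⁻¹' {x}).Finite)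
    (hb : ∀ y, (b ⁻¹' {y}).Finite) {f : X →₀ 𝔽} (hf : f ≠ 0) :
    ∃ y₁ y₂, y₁ ≠ y₂ ∧ spread a ha b f y₁ ≠ 0 ∧ spread a ha b f y₂ ≠ 0 := by
  obtain ⟨x, hx, hmin⟩ := Finset.exists_min_image f.support hX
    (Finsupp.support_nonempty_iff.mpr hf)
  have key : ∀ e, a e = x → hY (b e) < hX x → spread a ha b f (b e) ≠ 0 := by
    intro e he hlt
    rw [spread_apply a ha b hb, Finset.sum_eq_single e]
    · rw [he]; simpa using hx
    · intro e' he' hne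
      have hbe : b e' = b e := by simpa using he'
      by_contra hcon
      have hle := hmin (a e') (by simpa using hcon)
      refine hne (h.uniq e' e hbe ?_ ?_)
      · rw [hbe]; omega
      · rw [he]; exact hlt
    · intro hcon
      simp at hcon
  obtain ⟨e₁, e₂, hne, h₁, h₂, k₁, k₂⟩ := h.exists_two_lower x
  refine ⟨b e₁, b e₂, fun hbb => hne (h.uniq _ _ hbb ?_ ?_), key _ h₁ k₁, key _ h₂ k₂⟩
  · rwa [h₁]
  · rwa [h₂]

lemma IsHeight.spread_injective (h : IsHeight a b hX hY) (ha : ∀ x, (a ⁻¹' {x}).Finite)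
    (hb : ∀ y, (b ⁻¹' {y}).Finite) {f : X →₀ 𝔽} (hf : spread a ha b f = 0) : f = 0 := by
  by_contra hne
  obtain ⟨y₁, -, -, h₁, -⟩ := h.exists_two_support ha hb hne
  exact h₁ (by rw [hf]; rfl)

lemma IsHeight.spread_ne_single (h : IsHeight a b hX hY) (ha : ∀ x, (a ⁻¹' {x}).Finite)
    (hb : ∀ y, (b ⁻¹' {y}).Finite) (f : X →₀ 𝔽) (y : Y) :
    spread a ha b f ≠ Finsupp.single y 1 := by
  intro heq
  have hne : f ≠ 0 := by
    rintro rfl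
    rw [map_zero] at heq
    exact one_ne_zero (Finsupp.single_eq_zero.mp heq.symm)
  obtain ⟨y₁, y₂, h12, h₁, h₂⟩ := h.exists_two_support ha hb hne
  rw [heq, Finsupp.single_apply_ne_zero] at h₁ h₂
  exact h12 (h₁.1.trans h₂.1.symm)

end Bipartite

section Cosets

variable {G : Type*} [Group G] {K I : Subgroup G}

/-- The elements `1` and `γ u` (`u ∈ U`) represent the cosets `K / I` without repetition. -/
def IsStarReps (K I : Subgroup G) (U : Finset G) (γ : G → G) : Prop :=
  (∀ u ∈ U, γ u ∈ K ∧ γ u ∉ I) ∧ ∀ k ∈ K, k ∉ I → ∃! u, u ∈ U ∧ (γ u)⁻¹ * k ∈ I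

lemma IsStarReps.finite_fiber {U : Finset G} {γ : G → G} (hIK : I ≤ K) (h : IsStarReps K I U γ)
    (x : G ⧸ K) : (Subgroup.quotientMapOfLE hIK ⁻¹' {x}).Finite := by
  induction x using QuotientGroup.induction_on with
  | H g =>
  refine ((insert (g : G ⧸ I) (U.image fun u => ((g * γ u : G) : G ⧸ I))).finite_toSet).subset ?_
  intro e he
  induction e using QuotientGroup.induction_on with
  | H k =>
  have hk : g⁻¹ * k ∈ K := QuotientGroup.eq.mp (Eq.symm he)
  simp only [Finset.coe_insert, Finset.coe_image, Set.mem_insert_iff, Set.mem_image]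
  by_cases hI : g⁻¹ * k ∈ I
  · exact Or.inl (QuotientGroup.eq.mpr hI).symm
  · obtain ⟨u, ⟨hu, hu'⟩, -⟩ := h.2 _ hk hI
    refine Or.inr ⟨u, hu, QuotientGroup.eq.mpr ?_⟩
    simpa [mul_assoc] using hu'

variable {𝔽 : Type*} [Field 𝔽]

lemma IsStarReps.pull_single {U : Finset G} {γ : G → G} (hIK : I ≤ K) (h : IsStarReps K I U γ)
    (hfin : ∀ x, (Subgroup.quotientMapOfLE hIK ⁻¹' {x}).Finite) (g : G) :
    pull 𝔽 (Subgroup.quotientMapOfLE hIK) hfin (Finsupp.single (g : G ⧸ K) 1) =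
      Finsupp.single (g : G ⧸ I) 1 + ∑ u ∈ U, Finsupp.single ((g * γ u : G) : G ⧸ I) 1 := by
  ext e
  induction e using QuotientGroup.induction_on with
  | H k =>
  rw [pull_apply, Finsupp.add_apply, Finsupp.finsetSum_apply]
  have hq : Subgroup.quotientMapOfLE hIK (k : G ⧸ I) = (k : G ⧸ K) := rfl
  rw [hq]
  simp only [Finsupp.single_apply, QuotientGroup.eq, mul_inv_rev]
  by_cases hK : g⁻¹ * k ∈ K
  · by_cases hI : g⁻¹ * k ∈ I
    · rw [if_pos hK, if_pos hI, Finset.sum_eq_zero, add_zero]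
      intro u hu
      rw [if_neg]
      intro hc
      refine (h.1 u hu).2 ?_
      have := mul_mem hI (inv_mem hc)
      simpa [mul_assoc] using this
    · obtain ⟨u, ⟨hu, hu'⟩, huniq⟩ := h.2 _ hK hI
      rw [if_pos hK, if_neg hI, zero_add, Finset.sum_eq_single u]
      · rw [if_pos]; simpa [mul_assoc] using hu'
      · intro w hw hne
        rw [if_neg]
        intro hc
        exact hne (huniq w ⟨hw, by simpa [mul_assoc] using hc⟩)
      · intro hc; exact absurd hu hc
  · rw [if_neg hK, if_neg (fun hc => hK (hIK hc)), zero_add, Finset.sum_eq_zero]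
    intro u hu
    rw [if_neg]
    intro hc
    refine hK ?_
    have := mul_mem (h.1 u hu).1 (hIK hc)
    simpa [mul_assoc] using this

lemma IsStarReps.push_pull {U : Finset G} {γ : G → G} (hIK : I ≤ K) (h : IsStarReps K I U γ)
    (hfin : ∀ x, (Subgroup.quotientMapOfLE hIK ⁻¹' {x}).Finite) (hU : (U.card : 𝔽) = 0)
    (f : G ⧸ K →₀ 𝔽) :
    Finsupp.mapDomain (Subgroup.quotientMapOfLE hIK)
      (pull 𝔽 (Subgroup.quotientMapOfLE hIK) hfin f) = f := by
  have : Finsupp.lmapDomain 𝔽 𝔽 (Subgroup.quotientMapOfLE hIK) ∘ₗ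
      pull 𝔽 (Subgroup.quotientMapOfLE hIK) hfin = LinearMap.id := by
    refine Finsupp.lhom_ext' fun x => LinearMap.ext_ring ?_
    induction x using QuotientGroup.induction_on with
    | H g =>
    simp only [LinearMap.comp_apply, Finsupp.lsingle_apply, LinearMap.id_apply]
    rw [h.pull_single hIK hfin g, map_add, map_sum]
    simp only [Finsupp.lmapDomain_apply, Finsupp.mapDomain_single]
    have hq : ∀ k : G, Subgroup.quotientMapOfLE hIK (k : G ⧸ I) = (k : G ⧸ K) := fun _ => rfl
    have hs : ∑ u ∈ U, Finsupp.single (Subgroup.quotientMapOfLE hIK ((g * γ u : G) : G ⧸ I))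
        (1 : 𝔽) = ∑ u ∈ U, Finsupp.single (g : G ⧸ K) 1 := by
      refine Finset.sum_congr rfl fun u hu => ?_
      rw [hq, QuotientGroup.mk_mul_of_mem _ (h.1 u hu).1]
    rw [hs, Finset.sum_const, ← Nat.cast_smul_eq_nsmul 𝔽, hU, zero_smul, add_zero, hq]
  exact LinearMap.congr_fun this f

lemma pull_push_of_const {a : G ⧸ I → G ⧸ K} (ha : ∀ x, (a ⁻¹' {x}).Finite)
    (hone : ∀ f : G ⧸ K →₀ 𝔽, Finsupp.mapDomain a (pull 𝔽 a ha f) = f)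
    {c : G ⧸ I →₀ 𝔽} (hc : ∀ e e', a e = a e' → c e = c e') :
    pull 𝔽 a ha (Finsupp.mapDomain a c) = c := by
  ext e
  rw [pull_apply, mapDomain_apply_eq_sum_fiber a ha]
  have h1 := congrArg (fun f => f (a e)) (hone (Finsupp.single (a e) 1))
  simp only [mapDomain_apply_eq_sum_fiber a ha, pull_apply] at h1
  have h2 : ∀ e' ∈ (ha (a e)).toFinset, a e' = a e := fun e' he' => by simpa using he'
  rw [Finset.sum_congr rfl fun e' he' => by rw [h2 e' he']] at h1
  rw [Finset.sum_congr rfl fun e' he' => hc e' e (h2 e' he')]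
  simp only [Finsupp.single_eq_same, Finset.sum_const, nsmul_eq_mul, mul_one] at h1 ⊢
  rw [h1, one_mul]

end Cosets
end U21

namespace U21
namespace Setting

variable (S : Setting)

section Valuation

variable {S}

lemma mem_pE_iff {k : ℤ} {z : S.E} : z ∈ S.pE k ↔ S.ϖ ^ (-k) * z ∈ S.O := by
  constructor
  · rintro ⟨w, hw, rfl⟩
    rwa [← mul_assoc, ← zpow_add₀ S.unif_ne, neg_add_cancel, zpow_zero, one_mul]
  · intro h
    exact ⟨_, h, by rw [← mul_assoc, ← zpow_add₀ S.unif_ne, add_neg_cancel, zpow_zero, one_mul]⟩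

lemma zpow_mem_O {n : ℤ} (hn : 0 ≤ n) : S.ϖ ^ n ∈ S.O := by
  lift n to ℕ using hn
  rw [zpow_natCast]
  exact pow_mem S.unif_mem n

lemma zpow_not_mem_O {n : ℤ} (hn : n < 0) : S.ϖ ^ n ∉ S.O := by
  intro h
  refine S.unif_not_unit ⟨⟨⟨S.ϖ, S.unif_mem⟩, ⟨S.ϖ⁻¹, ?_⟩, ?_, ?_⟩, rfl⟩
  · have : S.ϖ⁻¹ = S.ϖ ^ n * S.ϖ ^ (-1 - n) := by
      rw [← zpow_add₀ S.unif_ne, add_sub_cancel, zpow_neg_one]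
    rw [this]
    exact mul_mem h (zpow_mem_O (by omega))
  · exact Subtype.ext (mul_inv_cancel₀ S.unif_ne)
  · exact Subtype.ext (inv_mul_cancel₀ S.unif_ne)

lemma unit_mul_zpow_mem_pE (u : S.Oˣ) (n k : ℤ) :
    (((u : S.O) : S.E) * S.ϖ ^ n) ∈ S.pE k ↔ k ≤ n := by
  have h1 : S.ϖ ^ (-k) * (((u : S.O) : S.E) * S.ϖ ^ n) = ((u : S.O) : S.E) * S.ϖ ^ (n - k) := by
    rw [mul_left_comm, ← zpow_add₀ S.unif_ne, neg_add_eq_sub]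
  rw [mem_pE_iff, h1]
  constructor
  · intro h
    by_contra hlt
    refine zpow_not_mem_O (S := S) (n := n - k) (by omega) ?_
    have := mul_mem ((u⁻¹ : S.Oˣ) : S.O).2 h
    have h2 : (((u⁻¹ : S.Oˣ) : S.O) : S.E) * ((u : S.O) : S.E) = 1 := by
      exact congrArg (fun x : S.O => (x : S.E)) u.inv_mul
    rwa [← mul_assoc, h2, one_mul] at this
  · intro h
    exact mul_mem (u : S.O).2 (zpow_mem_O (by omega))

lemma zero_mem_pE (k : ℤ) : (0 : S.E) ∈ S.pE k := ⟨0, zero_mem _, by simp⟩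

lemma pE_add {k : ℤ} {x y : S.E} (hx : x ∈ S.pE k) (hy : y ∈ S.pE k) : x + y ∈ S.pE k := by
  rw [mem_pE_iff] at *
  rw [mul_add]; exact add_mem hx hy

lemma pE_neg {k : ℤ} {x : S.E} (hx : x ∈ S.pE k) : -x ∈ S.pE k := by
  rw [mem_pE_iff] at *
  rw [mul_neg]; exact neg_mem hx

lemma pE_mul {j k : ℤ} {x y : S.E} (hx : x ∈ S.pE j) (hy : y ∈ S.pE k) :
    x * y ∈ S.pE (j + k) := by
  rw [mem_pE_iff] at *
  have : S.ϖ ^ (-(j + k)) * (x * y) = (S.ϖ ^ (-j) * x) * (S.ϖ ^ (-k) * y) := by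
    rw [neg_add, zpow_add₀ S.unif_ne]; ring
  rw [this]; exact mul_mem hx hy

lemma pE_mono {j k : ℤ} (h : j ≤ k) {x : S.E} (hx : x ∈ S.pE k) : x ∈ S.pE j := by
  rw [mem_pE_iff] at *
  have : S.ϖ ^ (-j) * x = S.ϖ ^ (k - j) * (S.ϖ ^ (-k) * x) := by
    rw [← mul_assoc, ← zpow_add₀ S.unif_ne]; congr 2; ring
  rw [this]; exact mul_mem (zpow_mem_O (by omega)) hx

lemma pE_conj {k : ℤ} {x : S.E} (hx : x ∈ S.pE k) : S.conj x ∈ S.pE k := by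
  rw [mem_pE_iff] at *
  have := S.conj_O _ hx
  rwa [map_mul, map_zpow₀, S.unif_conj] at this

lemma mem_pE_zero {x : S.E} : x ∈ S.pE 0 ↔ x ∈ S.O := by
  rw [mem_pE_iff]; simp

lemma zpow_mem_pE (n : ℤ) : S.ϖ ^ n ∈ S.pE n := ⟨1, one_mem _, by simp⟩

lemma mem_pE_of_mul {m k : ℤ} {c z : S.E} (hc : c ∉ S.pE (k + 1)) (hz : z * c ∈ S.pE (m + k)) :
    z ∈ S.pE m := by
  have hc0 : c ≠ 0 := by rintro rfl; exact hc (zero_mem_pE _)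
  by_cases hz0 : z = 0
  · rw [hz0]; exact zero_mem_pE _
  obtain ⟨n, u, rfl⟩ := S.disc c hc0
  obtain ⟨l, v, rfl⟩ := S.disc z hz0
  have hvu : ((v : S.O) : S.E) * S.ϖ ^ l * (((u : S.O) : S.E) * S.ϖ ^ n) =
      (((v * u : S.Oˣ) : S.O) : S.E) * S.ϖ ^ (l + n) := by
    rw [zpow_add₀ S.unif_ne]; push_cast; ring
  rw [hvu] at hz
  rw [unit_mul_zpow_mem_pE] at *
  omega

lemma norm_mem_pE_iff {k : ℤ} {z : S.E} : z * S.conj z ∈ S.pE k ↔ z ∈ S.pE ((k + 1) / 2) := by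
  by_cases hz0 : z = 0
  · simp [hz0, zero_mem_pE]
  obtain ⟨n, u, rfl⟩ := S.disc z hz0
  have hcu : ∃ v : S.Oˣ, ((v : S.O) : S.E) = S.conj ((u : S.O) : S.E) := by
    have h1 : S.conj ((u : S.O) : S.E) * S.conj (((u⁻¹ : S.Oˣ) : S.O) : S.E) = 1 := by
      rw [← map_mul]
      exact (congrArg (fun x : S.O => S.conj (x : S.E)) u.mul_inv).trans (map_one _)
    exact ⟨⟨⟨_, S.conj_O _ (u : S.O).2⟩, ⟨_, S.conj_O _ ((u⁻¹ : S.Oˣ) : S.O).2⟩,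
      Subtype.ext h1, Subtype.ext ((mul_comm _ _).trans h1)⟩, rfl⟩
  obtain ⟨v, hv⟩ := hcu
  have h2 : ((u : S.O) : S.E) * S.ϖ ^ n * S.conj (((u : S.O) : S.E) * S.ϖ ^ n) =
      (((u * v : S.Oˣ) : S.O) : S.E) * S.ϖ ^ (n + n) := by
    rw [map_mul, map_zpow₀, S.unif_conj, ← hv, zpow_add₀ S.unif_ne]; push_cast; ring
  rw [h2, unit_mul_zpow_mem_pE, unit_mul_zpow_mem_pE]
  omega

lemma exists_not_mem_pE {c : S.E} (hc : c ≠ 0) : ∃ k, c ∉ S.pE k := by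
  obtain ⟨n, u, rfl⟩ := S.disc c hc
  exact ⟨n + 1, by rw [unit_mul_zpow_mem_pE]; omega⟩

lemma exists_mem_pE (c : S.E) : ∃ k, c ∈ S.pE k := by
  by_cases hc : c = 0
  · exact ⟨0, hc ▸ zero_mem_pE _⟩
  obtain ⟨n, u, rfl⟩ := S.disc c hc
  exact ⟨n, by rw [unit_mul_zpow_mem_pE]⟩

variable (S) in
/-- The elements of `E` whose norm to `F` lies in `p_E ^ k`; a filtration of `E` indexed by
half-integral valuations. -/
def fil (k : ℤ) : AddSubgroup S.E where
  carrier := S.pE ((k + 1) / 2)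
  add_mem' := pE_add
  zero_mem' := zero_mem_pE _
  neg_mem' := pE_neg

lemma mem_fil {k : ℤ} {z : S.E} : z ∈ S.fil k ↔ z ∈ S.pE ((k + 1) / 2) := Iff.rfl

lemma mem_fil_iff_norm {k : ℤ} {z : S.E} : z ∈ S.fil k ↔ z * S.conj z ∈ S.pE k :=
  norm_mem_pE_iff.symm

lemma fil_mono {j k : ℤ} (h : (j + 1) / 2 ≤ (k + 1) / 2) {z : S.E} (hz : z ∈ S.fil k) :
    z ∈ S.fil j := pE_mono h hz

lemma fil_mul {j k : ℤ} {x y : S.E} (hx : x ∈ S.fil j) (hy : y ∈ S.fil k) :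
    x * y ∈ S.fil (j + k) := by
  rw [mem_fil_iff_norm] at *
  have := pE_mul hx hy
  rw [map_mul]
  convert this using 1
  ring

lemma fil_mul' {j k l : ℤ} (h : (l + 1) / 2 ≤ (j + k + 1) / 2) {x y : S.E} (hx : x ∈ S.fil j)
    (hy : y ∈ S.fil k) : x * y ∈ S.fil l := fil_mono h (fil_mul hx hy)

lemma fil_conj {k : ℤ} {x : S.E} (hx : x ∈ S.fil k) : S.conj x ∈ S.fil k := pE_conj hx

lemma one_mem_fil_zero : (1 : S.E) ∈ S.fil 0 := mem_pE_zero.mpr (one_mem _)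

end Valuation

section Residue

variable {S}

lemma mem_mI_iff {x : S.O} : x ∈ S.mI ↔ (x : S.E) ∈ S.pE 1 := by
  rw [S.hmI]
  simp [pE]

instance mI_isPrime : S.mI.IsPrime where
  ne_top' := by
    rw [Ne, Ideal.eq_top_iff_one, mem_mI_iff]
    intro h
    have := (unit_mul_zpow_mem_pE (S := S) 1 0 1).mp (by simpa using h)
    omega
  mem_or_mem' := by
    intro x y h
    rw [mem_mI_iff] at h ⊢
    rw [mem_mI_iff]
    by_contra! hc
    have h0 : (x : S.E) ∈ S.pE 1 := by
      refine mem_pE_of_mul (k := 0) (c := (y : S.E)) (by simpa using hc.2) ?_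
      simpa using h
    exact hc.1 h0

lemma p_pos_q : 1 < S.q := by
  rw [S.hq]
  exact Nat.one_lt_pow S.hfdeg.ne' S.hp.one_lt

lemma p_mem_mI : ((S.p : S.O)) ∈ S.mI := by
  have h1 : (Fintype.card S.kE : S.kE) = 0 := Nat.cast_card_eq_zero S.kE
  have h2 : ((S.p : S.kE)) = 0 := by
    have h3 : Fintype.card S.kE = (S.p ^ S.fdeg) ^ 2 := by rw [← S.hq]; exact S.card_res
    rw [h3] at h1
    push_cast at h1
    exact pow_eq_zero_iff (S.hfdeg.ne') |>.mp (pow_eq_zero_iff two_ne_zero |>.mp h1)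
  rw [← Ideal.Quotient.eq_zero_iff_mem, map_natCast]
  exact h2

lemma p_mem_pE : (S.p : S.E) ∈ S.pE 1 := by
  have := mem_mI_iff.mp (p_mem_mI (S := S))
  simpa using this

lemma exists_pow_ne_self {R : Type*} [CommRing R] [IsDomain R] [Fintype R] {q : ℕ} (hq : 1 < q)
    (hcard : Fintype.card R = q ^ 2) : ∃ z : R, z ^ q ≠ z := by
  by_contra! hall
  have hne : (Polynomial.X ^ q - Polynomial.X : Polynomial R) ≠ 0 := by
    intro h
    have h1 := congrArg (fun P => Polynomial.coeff P q) h
    simp [Polynomial.coeff_X, hq.ne] at h1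
  have hdeg : (Polynomial.X ^ q - Polynomial.X : Polynomial R).natDegree ≤ q :=
    (Polynomial.natDegree_sub_le_of_le (Polynomial.natDegree_X_pow_le q)
      (Polynomial.natDegree_X_le.trans hq.le)).trans (max_self q).le
  have hle := Polynomial.card_le_degree_of_subset_roots
    (p := (Polynomial.X ^ q - Polynomial.X : Polynomial R)) (Z := Finset.univ) (by
      intro z _
      rw [Polynomial.mem_roots hne]
      simp [hall z])
  rw [Finset.card_univ, hcard] at hle
  exact absurd (hle.trans hdeg) (not_le.mpr (lt_self_pow₀ hq one_lt_two))

lemma exists_conj_sub_not_mem : ∃ x ∈ S.O, x - S.conj x ∉ S.pE 1 := by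
  by_contra! hc
  have hall : ∀ z : S.kE, z ^ S.q = z := by
    intro z
    obtain ⟨x, rfl⟩ := Ideal.Quotient.mk_surjective z
    rw [← S.res_frob, Ideal.Quotient.eq, mem_mI_iff]
    have := pE_neg (hc x x.2)
    simpa using this
  have : IsDomain S.kE := Ideal.Quotient.isDomain S.mI
  obtain ⟨z, hz⟩ := exists_pow_ne_self (R := S.kE) p_pos_q S.card_res
  exact hz (hall z)

lemma exists_trace_zero (k : ℤ) :
    ∃ y : S.E, y + S.conj y = 0 ∧ y ∈ S.pE k ∧ y ∉ S.pE (k + 1) := by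
  obtain ⟨x, hx, hx'⟩ := exists_conj_sub_not_mem (S := S)
  have hO : x - S.conj x ∈ S.O := sub_mem hx (S.conj_O _ hx)
  refine ⟨S.ϖ ^ k * (x - S.conj x), ?_, ⟨_, hO, rfl⟩, ?_⟩
  · rw [map_mul, map_sub, S.conj_invol, map_zpow₀, S.unif_conj]; ring
  · intro h
    have := pE_mul (zpow_mem_pE (S := S) (-k)) h
    rw [← mul_assoc, ← zpow_add₀ S.unif_ne, neg_add_cancel, zpow_zero, one_mul,
      neg_add_cancel_left] at this
    exact hx' this

/-- A finite-valued function separating the elements of `fil k` modulo `fil (k + 1)`. -/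
def filRes (k : ℤ) (z : S.E) : S.kE :=
  if h : S.ϖ ^ (-((k + 1) / 2)) * z ∈ S.O then Ideal.Quotient.mk S.mI ⟨_, h⟩ else 0

lemma sub_mem_fil_of_filRes_eq {k : ℤ} {z w : S.E} (hz : z ∈ S.fil k) (hw : w ∈ S.fil k)
    (h : filRes k z = filRes k w) : z - w ∈ S.fil (k + 1) := by
  rw [mem_fil, mem_pE_iff] at hz hw
  rw [filRes, filRes, dif_pos hz, dif_pos hw, Ideal.Quotient.eq, mem_mI_iff] at h
  have := pE_mul (zpow_mem_pE (S := S) ((k + 1) / 2)) h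
  rw [AddSubgroupClass.coe_sub, ← mul_sub, ← mul_assoc, ← zpow_add₀ S.unif_ne, add_neg_cancel, zpow_zero,
    one_mul] at this
  exact pE_mono (by omega) this

end Residue

end Setting
end U21

namespace U21
namespace Setting

variable {S : Setting}

section Matrices

lemma mat_one : S.mat 1 = 1 := rfl

lemma mat_mul (g h : S.GG) : S.mat (g * h) = S.mat g * S.mat h := rfl

lemma mat_injective : Function.Injective S.mat := fun _ _ h => Subtype.ext (Units.ext h)

lemma mat_mul_apply (g h : S.GG) (i j : Fin 3) :
    S.mat (g * h) i j = S.mat g i 0 * S.mat h 0 j + S.mat g i 1 * S.mat h 1 j +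
      S.mat g i 2 * S.mat h 2 j := by
  rw [mat_mul, Matrix.mul_apply, Fin.sum_univ_three]

lemma mat_form (g : S.GG) : (S.mat g).transpose * S.betaM * (S.mat g).map S.conj = S.betaM := g.2

/-- Any two columns of an element of `G` pair under the Hermitian form as the corresponding
basis vectors. -/
lemma col_form (g : S.GG) (i j : Fin 3) :
    S.mat g 2 i * S.conj (S.mat g 0 j) + S.mat g 1 i * S.conj (S.mat g 1 j) +
      S.mat g 0 i * S.conj (S.mat g 2 j) = S.betaM i j := by
  have h := congrFun (congrFun (mat_form g) i) j
  rw [← h]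
  simp [Matrix.mul_apply, Fin.sum_univ_three, betaM]

lemma betaM_mul_apply (M : S.M3) (i j : Fin 3) : (S.betaM * M) i j = M i.rev j := by
  rw [Matrix.mul_apply, Fin.sum_univ_three]
  fin_cases i <;> simp [betaM]

lemma mul_betaM_apply (M : S.M3) (i j : Fin 3) : (M * S.betaM) i j = M i j.rev := by
  rw [Matrix.mul_apply, Fin.sum_univ_three]
  fin_cases j <;> simp [betaM]

lemma mat_inv (g : S.GG) : S.mat g⁻¹ = S.betaM * ((S.mat g).map S.conj).transpose * S.betaM := by
  have h := mat_form g
  have h1 : ((S.mat g).map S.conj).transpose * S.betaM * S.mat g = S.betaM := by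
    have h2 := congrArg Matrix.transpose h
    simp only [Matrix.transpose_mul, Matrix.transpose_transpose] at h2
    have hb : S.betaM.transpose = S.betaM := by
      ext i j; fin_cases i <;> fin_cases j <;> rfl
    rw [hb, ← mul_assoc] at h2
    exact h2
  have h3 : (S.betaM * ((S.mat g).map S.conj).transpose * S.betaM) * S.mat g = 1 := by
    rw [mul_assoc, mul_assoc, ← mul_assoc _ S.betaM, h1, beta_mul_beta]
  have h4 : S.mat g * S.mat g⁻¹ = 1 := by rw [← mat_mul, mul_inv_cancel, mat_one]
  exact (left_inv_eq_right_inv h3 h4).symm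

lemma mat_inv_apply (g : S.GG) (i j : Fin 3) :
    S.mat g⁻¹ i j = S.conj (S.mat g j.rev i.rev) := by
  rw [mat_inv, mul_betaM_apply, betaM_mul_apply]
  rfl

lemma row_form (g : S.GG) (i : Fin 3) :
    S.mat g i 2 * S.conj (S.mat g i 0) + S.mat g i 1 * S.conj (S.mat g i 1) +
      S.mat g i 0 * S.conj (S.mat g i 2) = S.betaM i i := by
  have h := col_form g⁻¹ i.rev i.rev
  simp only [mat_inv_apply, Fin.rev_rev, conj_invol] at h
  have hb : S.betaM i.rev i.rev = S.betaM i i := by fin_cases i <;> rfl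
  rw [← hb, ← h]
  simp only [show (Fin.rev 2 : Fin 3) = 0 from rfl, show (Fin.rev 1 : Fin 3) = 1 from rfl,
    show (Fin.rev 0 : Fin 3) = 2 from rfl]
  ring

end Matrices

section Parahoric

variable (S) in
/-- The maximal compact subgroups `K_r`; up to conjugacy they only depend on the parity of `r`. -/
def Kr (r : ℤ) : Subgroup S.GG where
  carrier := {g | ∀ i j : Fin 3, S.mat g i j ∈ S.fil (r * ((i : ℕ) - (j : ℕ)))}
  one_mem' i j := by
    rw [mat_one, Matrix.one_apply]
    split_ifs with h
    · subst h; simpa using one_mem_fil_zero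
    · exact zero_mem _
  mul_mem' := by
    intro a b ha hb i j
    have h : ∀ k : Fin 3, S.mat a i k * S.mat b k j ∈ S.fil (r * ((i : ℕ) - (j : ℕ))) := by
      intro k
      convert fil_mul (ha i k) (hb k j) using 2
      ring
    rw [mat_mul_apply]
    exact add_mem (add_mem (h 0) (h 1)) (h 2)
  inv_mem' := by
    intro a ha i j
    rw [mat_inv_apply]
    convert fil_conj (ha j.rev i.rev) using 3
    simp only [Fin.val_rev]
    omega

lemma mem_Kr_iff {r : ℤ} {g : S.GG} : g ∈ S.Kr r ↔
    (S.mat g 0 0 ∈ S.fil 0 ∧ S.mat g 0 1 ∈ S.fil (-r) ∧ S.mat g 0 2 ∈ S.fil (-2 * r)) ∧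
    (S.mat g 1 0 ∈ S.fil r ∧ S.mat g 1 1 ∈ S.fil 0 ∧ S.mat g 1 2 ∈ S.fil (-r)) ∧
    (S.mat g 2 0 ∈ S.fil (2 * r) ∧ S.mat g 2 1 ∈ S.fil r ∧ S.mat g 2 2 ∈ S.fil 0) := by
  have h : g ∈ S.Kr r ↔ ∀ i j : Fin 3, S.mat g i j ∈ S.fil (r * ((i : ℕ) - (j : ℕ))) := Iff.rfl
  have e : r * 2 = 2 * r := by ring
  simp [h, Fin.forall_fin_succ, e]

lemma fil_of_norm_eq {k j : ℤ} {x y z : S.E} (h : x * S.conj y + z * S.conj z + y * S.conj x = 0)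
    (hx : x ∈ S.pE j) (hy : y ∈ S.pE (k - j)) : z ∈ S.fil k := by
  rw [mem_fil_iff_norm]
  have h1 : z * S.conj z = -(x * S.conj y) + -(y * S.conj x) := by linear_combination h
  rw [h1]
  refine pE_add (pE_neg ?_) (pE_neg ?_)
  · simpa using pE_mul hx (pE_conj hy)
  · simpa using pE_mul hy (pE_conj hx)

lemma mem_Kr_succ_of_mem {r : ℤ} {g : S.GG} (hg : g ∈ S.Kr r) (h : S.mat g 2 0 ∈ S.pE (r + 1)) :
    g ∈ S.Kr (r + 1) := by
  rw [mem_Kr_iff] at hg ⊢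
  obtain ⟨⟨h00, h01, h02⟩, ⟨h10, h11, h12⟩, h20, h21, h22⟩ := hg
  refine ⟨⟨h00, fil_mono (by omega) h01, fil_mono (by omega) h02⟩,
    ⟨?_, h11, fil_mono (by omega) h12⟩, pE_mono (by omega) h, ?_, h22⟩
  · exact fil_of_norm_eq (col_form g 0 0) h (pE_mono (by omega) h00)
  · have := row_form g 2
    exact fil_of_norm_eq (j := 0) this (pE_mono (by omega) h22) (by simpa using h)

lemma mem_Kr_of_mem_succ {r : ℤ} {g : S.GG} (hg : g ∈ S.Kr (r + 1))
    (h : S.mat g 0 2 ∈ S.pE (-r)) : g ∈ S.Kr r := by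
  rw [mem_Kr_iff] at hg ⊢
  obtain ⟨⟨h00, h01, h02⟩, ⟨h10, h11, h12⟩, h20, h21, h22⟩ := hg
  refine ⟨⟨h00, ?_, pE_mono (by omega) h⟩,
    ⟨fil_mono (by omega) h10, h11, ?_⟩, fil_mono (by omega) h20, fil_mono (by omega) h21, h22⟩
  · exact fil_of_norm_eq (row_form g 0) h (pE_mono (by omega) h00)
  · exact fil_of_norm_eq (j := 0) (col_form g 2 2) (pE_mono (by omega) h22) (by simpa using h)

end Parahoric

section Unipotent

lemma eq_nM_mul {x y x' y' : S.E} :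
    S.nM x y * S.nM x' y' = S.nM (x + x') (y + y' - x * S.conj x') := by
  ext i j
  fin_cases i <;> fin_cases j <;>
    simp [nM, Matrix.mul_apply, Fin.sum_univ_three] <;> ring

lemma nM_zero : S.nM 0 0 = 1 := by
  ext i j
  fin_cases i <;> fin_cases j <;> simp [nM]

variable (S) in
/-- The element `n(x,y)` of `G`. -/
def nE (x y : S.E) (h : x * S.conj x + y + S.conj y = 0) : S.GG :=
  ⟨⟨S.nM x y, S.nM (-x) (S.conj y),
    by rw [eq_nM_mul, ← nM_zero]; congr 1 <;> simp [← h]; ring,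
    by rw [eq_nM_mul, ← nM_zero]; congr 1 <;> simp [← h]; ring⟩, by
    change (S.nM x y).transpose * S.betaM * (S.nM x y).map S.conj = S.betaM
    ext i j
    fin_cases i <;> fin_cases j <;>
      simp [nM, betaM, Matrix.mul_apply, Fin.sum_univ_three,
        conj_invol]
    linear_combination h⟩

lemma mat_nE {x y : S.E} (h : x * S.conj x + y + S.conj y = 0) : S.mat (S.nE x y h) = S.nM x y :=
  rfl

lemma mat_inv_of_eq_nM {g : S.GG} {x y : S.E} (hg : S.mat g = S.nM x y) :
    S.mat g⁻¹ = S.nM (-x) (S.conj y) := by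
  ext i j
  rw [mat_inv_apply, hg]
  fin_cases i <;> fin_cases j <;> simp [nM, Fin.rev, conj_invol]

lemma mem_fil_of_trace {k : ℤ} {x y : S.E} (h : x * S.conj x + y + S.conj y = 0)
    (hy : y ∈ S.pE k) : x ∈ S.fil k := by
  rw [mem_fil_iff_norm]
  have h1 : x * S.conj x = -y + -S.conj y := by linear_combination h
  rw [h1]
  exact pE_add (pE_neg hy) (pE_neg (pE_conj hy))

variable (S) in
/-- The filtration subgroups `N_k`. -/
def Nsub (k : ℤ) : Subgroup S.GG where
  carrier := S.Nk k
  one_mem' := ⟨0, 0, by simp, zero_mem_pE _, by rw [nM_zero]; rfl⟩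
  mul_mem' := by
    rintro a b ⟨x, y, h, hy, ha⟩ ⟨x', y', h', hy', hb⟩
    refine ⟨x + x', y + y' - x * S.conj x', ?_, ?_, by rw [mat_mul, ha, hb, eq_nM_mul]⟩
    · simp only [map_add, map_sub, map_mul, conj_invol]
      linear_combination h + h'
    · have hx := mem_fil_of_trace h hy
      have hx' := mem_fil_of_trace h' hy'
      rw [sub_eq_add_neg]
      refine pE_add (pE_add hy hy') (pE_neg ?_)
      exact pE_mono (by omega) (fil_mul hx (fil_conj hx'))
  inv_mem' := by
    rintro a ⟨x, y, h, hy, ha⟩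
    refine ⟨-x, S.conj y, ?_, pE_conj hy, mat_inv_of_eq_nM ha⟩
    rw [conj_invol, map_neg]
    linear_combination h

lemma mem_Nsub_iff {k : ℤ} {g : S.GG} {x y : S.E} (hg : S.mat g = S.nM x y)
    (h : x * S.conj x + y + S.conj y = 0) : g ∈ S.Nsub k ↔ y ∈ S.pE k := by
  constructor
  · rintro ⟨x', y', h', hy, hg'⟩
    rw [hg] at hg'
    have := congrFun (congrFun hg' 0) 2
    have e : y = y' := this
    rwa [e]
  · intro hy
    exact ⟨x, y, h, hy, hg⟩

lemma Nsub_mono {j k : ℤ} (h : j ≤ k) : S.Nsub k ≤ S.Nsub j := by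
  rintro g ⟨x, y, hxy, hy, hg⟩
  exact ⟨x, y, hxy, pE_mono h hy, hg⟩

lemma Nsub_le_Kr {k r : ℤ} (h : -r ≤ k) : S.Nsub k ≤ S.Kr r := by
  rintro g ⟨x, y, hxy, hy, hg⟩
  have hx := mem_fil_of_trace hxy hy
  rw [mem_Kr_iff, hg]
  refine ⟨⟨one_mem_fil_zero, fil_mono (by omega) hx, pE_mono (by omega) hy⟩,
    ⟨zero_mem _, one_mem_fil_zero, neg_mem (fil_conj (fil_mono (by omega) hx))⟩,
    zero_mem _, zero_mem _, one_mem_fil_zero⟩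

lemma mem_Nsub_of_mem_Kr {r j : ℤ} {g : S.GG} (hj : g ∈ S.Nsub j) (hg : g ∈ S.Kr r) :
    g ∈ S.Nsub (-r) := by
  obtain ⟨x, y, hxy, hy, hm⟩ := hj
  refine ⟨x, y, hxy, ?_, hm⟩
  have := (mem_Kr_iff.mp hg).1.2.2
  rw [hm] at this
  exact pE_mono (by omega) this

lemma Nsub_conj_mem {k : ℤ} {g h : S.GG} (hg : g ∈ S.Nsub k) (hh : h ∈ S.Nsub (k + 1)) :
    g * h * g⁻¹ ∈ S.Nsub (k + 1) := by
  obtain ⟨x, y, h1, hy, hm⟩ := hg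
  obtain ⟨x', y', h1', hy', hm'⟩ := hh
  have hx := mem_fil_of_trace h1 hy
  have hx' := mem_fil_of_trace h1' hy'
  refine ⟨x', y' + (x' * S.conj x + -(x * S.conj x')), ?_, ?_, ?_⟩
  · simp only [map_add, map_neg, map_mul, conj_invol]
    linear_combination h1'
  · refine pE_add hy' (pE_add ?_ (pE_neg ?_))
    · exact pE_mono (by omega) (fil_mul hx' (fil_conj hx))
    · exact pE_mono (by omega) (fil_mul hx (fil_conj hx'))
  · rw [mat_mul, mat_mul, hm, hm', mat_inv_of_eq_nM hm, eq_nM_mul, eq_nM_mul]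
    congr 1
    · ring
    · simp only [map_neg]
      linear_combination h1

lemma finite_Nsub_quotient (k : ℤ) :
    Finite (S.Nsub k ⧸ (S.Nsub (k + 1)).subgroupOf (S.Nsub k)) := by
  let f : S.Nsub k → S.kE × S.kE :=
    fun g => (filRes k (S.mat g.1 0 1), filRes (2 * k) (S.mat g.1 0 2))
  have key : ∀ g h : S.Nsub k, f g = f h →
      (g : S.Nsub k ⧸ (S.Nsub (k + 1)).subgroupOf (S.Nsub k)) = h := by
    rintro ⟨g, x, y, h1, hy, hm⟩ ⟨h, x', y', h1', hy', hm'⟩ hf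
    have hx := mem_fil_of_trace h1 hy
    have hx' := mem_fil_of_trace h1' hy'
    simp only [f, hm, hm', Prod.mk.injEq] at hf
    have e1 : x' - x ∈ S.fil (k + 1) := sub_mem_fil_of_filRes_eq hx' hx hf.1.symm
    have e2 : y' - y ∈ S.fil (2 * k + 1) := sub_mem_fil_of_filRes_eq
      (pE_mono (by omega) hy') (pE_mono (by omega) hy) hf.2.symm
    rw [QuotientGroup.eq, Subgroup.mem_subgroupOf]
    refine ⟨x' - x, (y' - y) + x * S.conj (x' - x), ?_, ?_, ?_⟩
    · simp only [map_add, map_sub, map_mul, conj_invol]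
      linear_combination h1' - h1
    · refine pE_add (pE_mono (by omega) e2) (pE_mono (by omega) (fil_mul hx (fil_conj e1)))
    · change S.mat (g⁻¹ * h) = _
      rw [mat_mul, hm', mat_inv_of_eq_nM hm, eq_nM_mul]
      congr 1
      · ring
      · simp only [map_sub]
        linear_combination h1
  refine Finite.of_injective (fun q : S.Nsub k ⧸ (S.Nsub (k + 1)).subgroupOf (S.Nsub k) =>
    f q.out) fun a b hab => ?_
  have := key _ _ hab
  rwa [QuotientGroup.out_eq', QuotientGroup.out_eq'] at this

lemma mat_pow_of_eq_nM {g : S.GG} {y : S.E} (hg : S.mat g = S.nM 0 y) (n : ℕ) :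
    S.mat (g ^ n) = S.nM 0 (n * y) := by
  induction n with
  | zero => rw [pow_zero, Nat.cast_zero, zero_mul, nM_zero]; rfl
  | succ n ih =>
    rw [pow_succ, mat_mul, ih, hg, eq_nM_mul]
    congr 1
    · simp
    · push_cast; simp; ring

lemma p_dvd_card_Nsub_quotient (k : ℤ) :
    S.p ∣ Nat.card (S.Nsub k ⧸ (S.Nsub (k + 1)).subgroupOf (S.Nsub k)) := by
  have := finite_Nsub_quotient (S := S) k
  have hnormal : ((S.Nsub (k + 1)).subgroupOf (S.Nsub k)).Normal :=
    ⟨fun h hh g => Nsub_conj_mem g.2 hh⟩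
  obtain ⟨y, hy0, hy, hy'⟩ := exists_trace_zero (S := S) k
  have hrel : (0 : S.E) * S.conj 0 + y + S.conj y = 0 := by rw [zero_mul, zero_add, hy0]
  let t : S.Nsub k := ⟨S.nE 0 y hrel, 0, y, hrel, hy, rfl⟩
  have hord : orderOf (t : S.Nsub k ⧸ (S.Nsub (k + 1)).subgroupOf (S.Nsub k)) = S.p := by
    have : Fact S.p.Prime := ⟨S.hp⟩
    refine orderOf_eq_prime ?_ ?_
    · rw [← QuotientGroup.mk_pow, QuotientGroup.eq_one_iff, Subgroup.mem_subgroupOf]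
      refine ⟨0, (S.p : S.E) * y, ?_, ?_, mat_pow_of_eq_nM rfl _⟩
      · rw [map_mul, map_natCast]
        linear_combination (S.p : S.E) * hy0
      · rw [add_comm]
        exact pE_mul p_mem_pE hy
    · rw [Ne, QuotientGroup.eq_one_iff, Subgroup.mem_subgroupOf, mem_Nsub_iff (mat_nE hrel) hrel]
      exact hy'
  rw [← hord]
  exact orderOf_dvd_natCard _

end Unipotent
end Setting
end U21

namespace U21
namespace Setting

variable {S : Setting}

section Representatives

lemma exists_isReps {A B : Subgroup S.GG} [Finite (A ⧸ B.subgroupOf A)] :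
    ∃ U : Finset S.GG, S.IsReps A B U ∧ U.card = Nat.card (A ⧸ B.subgroupOf A) := by
  have := Fintype.ofFinite (A ⧸ B.subgroupOf A)
  have hinj : Function.Injective fun z : A ⧸ B.subgroupOf A => ((z.out : A) : S.GG) :=
    fun z w hzw => Quotient.out_injective (Subtype.ext hzw)
  have hmem : ∀ (a : A) (z : A ⧸ B.subgroupOf A),
      (a : S.GG)⁻¹ * (z.out : A) ∈ B ↔ (a : A ⧸ B.subgroupOf A) = z := by
    intro a z
    conv_rhs => rw [← QuotientGroup.out_eq' z, QuotientGroup.eq, Subgroup.mem_subgroupOf]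
    rfl
  refine ⟨Finset.univ.map ⟨_, hinj⟩, ⟨?_, fun a ha => ?_⟩, ?_⟩
  · intro u hu
    obtain ⟨z, -, rfl⟩ := Finset.mem_map.mp (Finset.mem_coe.mp hu)
    exact z.out.2
  · refine ⟨((⟨a, ha⟩ : A) : A ⧸ B.subgroupOf A).out, ⟨?_, ?_⟩, ?_⟩
    · exact Finset.mem_map.mpr ⟨_, Finset.mem_univ _, rfl⟩
    · exact (hmem ⟨a, ha⟩ _).mpr rfl
    · rintro u ⟨hu, hu'⟩
      obtain ⟨z, -, rfl⟩ := Finset.mem_map.mp hu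
      rw [(hmem ⟨a, ha⟩ z).mp hu']
      rfl
  · rw [Finset.card_map, Finset.card_univ, Nat.card_eq_fintype_card]

lemma IsReps.eq_of_inv_mul_mem {A B : Subgroup S.GG} {U : Finset S.GG} (h : S.IsReps A B U)
    {u v : S.GG} (hu : u ∈ U) (hv : v ∈ U) (huv : u⁻¹ * v ∈ B) : u = v :=
  (h.2 u (h.1 hu)).unique ⟨hu, by simp [one_mem]⟩ ⟨hv, huv⟩

lemma IsReps.injOn_mul {A B D : Subgroup S.GG} {U V : Finset S.GG} (hU : S.IsReps A B U)
    (hV : S.IsReps B D V) :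
    Set.InjOn (fun p : S.GG × S.GG => p.1 * p.2) (U ×ˢ V : Finset (S.GG × S.GG)) := by
  rintro ⟨u, v⟩ h ⟨u', v'⟩ h' (heq : u * v = u' * v')
  simp only [Finset.coe_product, Set.mem_prod, Finset.mem_coe] at h h'
  have huv : u⁻¹ * u' = v * v'⁻¹ := by
    rw [inv_mul_eq_iff_eq_mul, ← mul_assoc, heq, mul_inv_cancel_right]
  have hu := hU.eq_of_inv_mul_mem h.1 h'.1 (huv ▸ mul_mem (hV.1 h.2) (inv_mem (hV.1 h'.2)))
  subst hu
  rw [mul_left_cancel heq]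

lemma IsReps.mul {A B D : Subgroup S.GG} {U V : Finset S.GG} (hU : S.IsReps A B U)
    (hV : S.IsReps B D V) (hBA : B ≤ A) (hDB : D ≤ B) :
    S.IsReps A D ((U ×ˢ V).image fun p => p.1 * p.2) := by
  refine ⟨?_, fun a ha => ?_⟩
  · intro x hx
    simp only [Finset.coe_image, Set.mem_image, Finset.mem_coe, Finset.mem_product] at hx
    obtain ⟨⟨u, v⟩, ⟨hu, hv⟩, rfl⟩ := hx
    exact mul_mem (hU.1 hu) (hBA (hV.1 hv))
  · obtain ⟨u, ⟨hu, hau⟩, huniq⟩ := hU.2 a ha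
    have hua : u⁻¹ * a ∈ B := by simpa using inv_mem hau
    obtain ⟨v, ⟨hv, hav⟩, hvuniq⟩ := hV.2 _ hua
    refine ⟨u * v, ⟨Finset.mem_image.mpr ⟨(u, v), Finset.mem_product.mpr ⟨hu, hv⟩, rfl⟩, ?_⟩, ?_⟩
    · simpa [mul_assoc] using hav
    · rintro x ⟨hx, hax⟩
      obtain ⟨⟨u', v'⟩, hp, rfl⟩ := Finset.mem_image.mp hx
      obtain ⟨hu', hv'⟩ := Finset.mem_product.mp hp
      have h1 : u' = u := by
        refine huniq u' ⟨hu', ?_⟩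
        have := mul_mem (hDB hax) (inv_mem (hV.1 hv'))
        simpa [mul_assoc] using this
      subst h1
      rw [hvuniq v' ⟨hv', by simpa [mul_assoc] using hax⟩]

lemma IsReps.isStarReps {A B K I : Subgroup S.GG} {U : Finset S.GG} {γ : S.GG → S.GG}
    (hU : S.IsReps A B U) (hγ : ∀ u ∈ A, γ u ∈ K ∧ γ u ∉ I)
    (hex : ∀ k ∈ K, k ∉ I → ∃ u ∈ A, (γ u)⁻¹ * k ∈ I)
    (hiff : ∀ u ∈ A, ∀ v ∈ A, (γ u)⁻¹ * γ v ∈ I ↔ u⁻¹ * v ∈ B) : IsStarReps K I U γ := by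
  refine ⟨fun u hu => hγ u (hU.1 hu), fun k hk hkI => ?_⟩
  obtain ⟨a, ha, hak⟩ := hex k hk hkI
  obtain ⟨u, ⟨hu, hau⟩, -⟩ := hU.2 a ha
  refine ⟨u, ⟨hu, ?_⟩, ?_⟩
  · have := mul_mem (inv_mem ((hiff a ha u (hU.1 hu)).mpr hau)) hak
    simpa [mul_assoc] using this
  · rintro v ⟨hv, hvk⟩
    have h : v⁻¹ * a ∈ B := by
      refine (hiff v (hU.1 hv) a ha).mp ?_
      have := mul_mem hvk (inv_mem hak)
      simpa [mul_assoc] using this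
    refine hU.eq_of_inv_mul_mem hv hu ?_
    have := mul_mem h hau
    simpa [mul_assoc] using this

end Representatives

section Star

/-- An element of `N` carrying an isotropic column with nonzero last entry to a column with
vanishing first entry. -/
lemma exists_unipotent_clearing {a b c : S.E}
    (h : c * S.conj a + b * S.conj b + a * S.conj c = 0) (hc : c ≠ 0) :
    ∃ x y, ∃ hxy : x * S.conj x + y + S.conj y = 0, y * c = a ∧
      (1 : S.E) * a + -x * b + S.conj y * c = 0 ∧ S.mat (S.nE x y hxy)⁻¹ = S.nM (-x) (S.conj y) := by
  have hc' : S.conj c ≠ 0 := by simpa using hc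
  have hxy : -S.conj b / S.conj c * S.conj (-S.conj b / S.conj c) + a / c + S.conj (a / c) = 0 := by
    simp only [map_div₀, map_neg, conj_invol]
    field_simp
    linear_combination h
  refine ⟨-S.conj b / S.conj c, a / c, hxy, by field_simp, ?_, mat_inv_of_eq_nM (mat_nE hxy)⟩
  simp only [map_div₀]
  field_simp
  linear_combination h

variable {r : ℤ} {β : S.GG}

/-- The matrix of the element `β_K`. -/
def betaR (S : Setting) (r : ℤ) : S.M3 := !![0, 0, S.ϖ ^ (-r); 0, 1, 0; S.ϖ ^ r, 0, 0]

lemma betaR_mul_apply (M : S.M3) :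
    (∀ j, (S.betaR r * M) 0 j = S.ϖ ^ (-r) * M 2 j) ∧ (∀ j, (S.betaR r * M) 1 j = M 1 j) ∧
    (∀ j, (S.betaR r * M) 2 j = S.ϖ ^ r * M 0 j) := by
  refine ⟨fun j => ?_, fun j => ?_, fun j => ?_⟩ <;>
  simp [betaR, Matrix.mul_apply, Fin.sum_univ_three]

lemma betaR_mem_Kr (hβ : S.mat β = S.betaR r) : β ∈ S.Kr r := by
  rw [mem_Kr_iff, hβ]
  refine ⟨⟨zero_mem _, zero_mem _, ?_⟩, ⟨zero_mem _, one_mem_fil_zero, zero_mem _⟩,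
    ?_, zero_mem _, zero_mem _⟩
  · exact pE_mono (by omega) (zpow_mem_pE (S := S) (-r))
  · exact pE_mono (by omega) (zpow_mem_pE (S := S) r)

lemma zpow_not_mem_pE {m n : ℤ} (h : m < n) : S.ϖ ^ m ∉ S.pE n := by
  have := unit_mul_zpow_mem_pE (S := S) 1 m n
  rw [Units.val_one, OneMemClass.coe_one, one_mul] at this
  rw [this]
  omega

lemma zpow_mul_mem_pE_iff {m n : ℤ} {z : S.E} : S.ϖ ^ m * z ∈ S.pE n ↔ z ∈ S.pE (n - m) := by
  rw [mem_pE_iff, mem_pE_iff, ← mul_assoc, ← zpow_add₀ S.unif_ne]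
  ring_nf

lemma betaR_not_mem (hβ : S.mat β = S.betaR r) : β ∉ S.Kr (r + 1) := by
  intro h
  have h1 := (mem_Kr_iff.mp h).2.2.1
  rw [hβ] at h1
  exact zpow_not_mem_pE (S := S) (m := r) (n := r + 1) (by omega) (pE_mono (by omega) h1)

lemma betaR_not_mem' (hβ : S.mat β = S.betaR (r + 1)) : β ∉ S.Kr r := by
  intro h
  have h1 := (mem_Kr_iff.mp h).1.2.2
  rw [hβ] at h1
  exact zpow_not_mem_pE (S := S) (m := -(r + 1)) (n := -r) (by omega) (pE_mono (by omega) h1)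

lemma betaR_mul_self (hβ : S.mat β = S.betaR r) : β * β = 1 := by
  apply mat_injective
  rw [mat_mul, hβ, mat_one]
  ext i j
  fin_cases i <;> fin_cases j <;>
    simp [betaR, Matrix.mul_apply, Fin.sum_univ_three, inv_mul_cancel₀ (zpow_ne_zero r S.unif_ne),
      mul_inv_cancel₀ (zpow_ne_zero r S.unif_ne)]

lemma betaR_inv (hβ : S.mat β = S.betaR r) : β⁻¹ = β :=
  inv_eq_of_mul_eq_one_right (betaR_mul_self hβ)

/-- Conjugation by `β_K` exchanges upper and lower unipotent matrices. -/
lemma mat_beta_conj (hβ : S.mat β = S.betaR r) {g : S.GG} {x y : S.E} (hg : S.mat g = S.nM x y) :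
    S.mat (β * g * β) = S.n'M (-S.ϖ ^ r * S.conj x) (S.ϖ ^ (2 * r) * y) := by
  rw [mat_mul, mat_mul, hβ, hg]
  have h1 := inv_mul_cancel₀ (zpow_ne_zero r S.unif_ne)
  have h2 := mul_inv_cancel₀ (zpow_ne_zero r S.unif_ne)
  ext i j
  fin_cases i <;> fin_cases j <;>
    simp [betaR, nM, n'M, Matrix.mul_apply, Fin.sum_univ_three, h1, h2, unif_conj, conj_invol]
  · ring
  · rw [two_mul, zpow_add₀ S.unif_ne]
    ring

lemma beta_conj_mem_Kr_iff (hβ : S.mat β = S.betaR r) {g : S.GG} (hg : g ∈ S.Nsub (-r)) :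
    β * g * β ∈ S.Kr r ⊓ S.Kr (r + 1) ↔ g ∈ S.Nsub (-r + 1) := by
  have hK : β * g * β ∈ S.Kr r :=
    mul_mem (mul_mem (betaR_mem_Kr hβ) (Nsub_le_Kr le_rfl hg)) (betaR_mem_Kr hβ)
  obtain ⟨x, y, hxy, hy, hm⟩ := hg
  have h20 : S.mat (β * g * β) 2 0 = S.ϖ ^ (2 * r) * y := by rw [mat_beta_conj hβ hm]; rfl
  rw [mem_Nsub_iff hm hxy]
  have e : r + 1 - 2 * r = -r + 1 := by ring
  constructor
  · intro h
    have h1 := (mem_Kr_iff.mp h.2).2.2.1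
    rw [h20] at h1
    have h2 := zpow_mul_mem_pE_iff.mp (pE_mono (j := r + 1) (by omega) h1)
    rwa [e] at h2
  · intro h
    refine ⟨hK, mem_Kr_succ_of_mem hK ?_⟩
    rw [h20, zpow_mul_mem_pE_iff, e]
    exact h

lemma Nsub_le_inf : S.Nsub (-r) ≤ S.Kr r ⊓ S.Kr (r + 1) :=
  le_inf (Nsub_le_Kr le_rfl) (Nsub_le_Kr (by omega))

lemma isStarReps_Kr (hβ : S.mat β = S.betaR r) {U : Finset S.GG}
    (hU : S.IsReps (S.Nsub (-r)) (S.Nsub (-r + 1)) U) :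
    IsStarReps (S.Kr r) (S.Kr r ⊓ S.Kr (r + 1)) U fun u => u * β := by
  refine hU.isStarReps ?_ ?_ ?_
  · intro u hu
    refine ⟨mul_mem (Nsub_le_Kr le_rfl hu) (betaR_mem_Kr hβ), fun h => betaR_not_mem hβ ?_⟩
    exact ((S.Kr (r + 1)).mul_mem_cancel_left (Nsub_le_inf hu).2).mp h.2
  · intro k hk hkI
    have h20 : S.mat k 2 0 ∉ S.pE (r + 1) := fun h => hkI ⟨hk, mem_Kr_succ_of_mem hk h⟩
    have hc0 : S.mat k 2 0 ≠ 0 := fun h => h20 (h ▸ zero_mem_pE _)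
    obtain ⟨x, y, hxy, hyc, h0, hinv⟩ := exists_unipotent_clearing (col_form k 0 0) hc0
    have hu : S.nE x y hxy ∈ S.Nsub (-r) := by
      rw [mem_Nsub_iff (mat_nE hxy) hxy]
      refine mem_pE_of_mul h20 ?_
      rw [hyc]
      exact pE_mono (by omega) (mem_Kr_iff.mp hk).1.1
    refine ⟨_, hu, ?_⟩
    have hK : (S.nE x y hxy * β)⁻¹ * k ∈ S.Kr r :=
      mul_mem (inv_mem (mul_mem (Nsub_le_Kr le_rfl hu) (betaR_mem_Kr hβ))) hk
    refine ⟨hK, mem_Kr_succ_of_mem hK ?_⟩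
    rw [mul_inv_rev, betaR_inv hβ, mul_assoc, mat_mul, hβ, (betaR_mul_apply _).2.2, mat_mul_apply,
      hinv]
    change S.ϖ ^ r * (1 * _ + -x * _ + S.conj y * _) ∈ _
    rw [h0, mul_zero]
    exact zero_mem_pE _
  · intro u hu v hv
    rw [← beta_conj_mem_Kr_iff hβ (mul_mem (inv_mem hu) hv), mul_inv_rev, betaR_inv hβ]
    simp only [mul_assoc]

lemma mat_alpha : S.mat S.alphaE = S.alphaM := rfl

lemma mat_alpha_inv : S.mat S.alphaE⁻¹ = S.alphaMinv := rfl

lemma mat_beta_mul_alpha_inv (hβ : S.mat β = S.betaR r) :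
    S.mat (β * S.alphaE⁻¹) = S.betaR (r + 1) := by
  rw [mat_mul, hβ, mat_alpha_inv]
  ext i j
  fin_cases i <;> fin_cases j <;>
    simp [betaR, alphaMinv, Matrix.mul_apply, Fin.sum_univ_three, zpow_add₀ S.unif_ne, mul_comm]

lemma alpha_conj_mem_iff {g : S.GG} (hg : g ∈ S.Nsub (-r + 1)) :
    S.alphaE * g * S.alphaE⁻¹ ∈ S.Kr r ↔ g ∈ S.Nsub (-r + 2) := by
  obtain ⟨x, y, hxy, hy, hm⟩ := hg
  have hmat : S.mat (S.alphaE * g * S.alphaE⁻¹) =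
      S.nM (S.ϖ ^ (-1 : ℤ) * x) (S.ϖ ^ (-2 : ℤ) * y) := by
    rw [mat_mul, mat_mul, hm, mat_alpha, mat_alpha_inv]
    have h0 := S.unif_ne
    ext i j
    fin_cases i <;> fin_cases j <;>
      simp [alphaM, alphaMinv, nM, Matrix.mul_apply, Fin.sum_univ_three, unif_conj, h0]
    · ring
    · ring
  have hrel : S.ϖ ^ (-1 : ℤ) * x * S.conj (S.ϖ ^ (-1 : ℤ) * x) + S.ϖ ^ (-2 : ℤ) * y +
      S.conj (S.ϖ ^ (-2 : ℤ) * y) = 0 := by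
    simp only [map_mul, map_zpow₀, unif_conj]
    rw [show (-2 : ℤ) = -1 + -1 by norm_num, zpow_add₀ S.unif_ne]
    linear_combination (S.ϖ ^ (-1 : ℤ) * S.ϖ ^ (-1 : ℤ)) * hxy
  have hmem : S.alphaE * g * S.alphaE⁻¹ ∈ S.Nsub (-r - 1) :=
    (mem_Nsub_iff hmat hrel).mpr (zpow_mul_mem_pE_iff.mpr (pE_mono (by omega) hy))
  have e : -r - -2 = -r + 2 := by ring
  rw [mem_Nsub_iff hm hxy, ← e, ← zpow_mul_mem_pE_iff, ← mem_Nsub_iff hmat hrel]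
  exact ⟨mem_Nsub_of_mem_Kr hmem, fun h => Nsub_le_Kr le_rfl h⟩

lemma isStarReps_Kr_succ (hβ : S.mat β = S.betaR r) {U : Finset S.GG}
    (hU : S.IsReps (S.Nsub (-r + 1)) (S.Nsub (-r + 2)) U) :
    IsStarReps (S.Kr (r + 1)) (S.Kr r ⊓ S.Kr (r + 1)) U fun u => β * u * S.alphaE⁻¹ := by
  have hβ' := mat_beta_mul_alpha_inv hβ
  have hdec : ∀ u : S.GG, β * u * S.alphaE⁻¹ = β * u * β * (β * S.alphaE⁻¹) := by
    intro u
    rw [← mul_assoc, mul_assoc (β * u) β β, betaR_mul_self hβ, mul_one]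
  have hle : S.Nsub (-r + 1) ≤ S.Nsub (-r) := Nsub_mono (by omega)
  have hI : ∀ u ∈ S.Nsub (-r + 1), β * u * β ∈ S.Kr r ⊓ S.Kr (r + 1) :=
    fun u hu => (beta_conj_mem_Kr_iff hβ (hle hu)).mpr hu
  have hK : ∀ u ∈ S.Nsub (-r + 1), β * u * S.alphaE⁻¹ ∈ S.Kr (r + 1) := by
    intro u hu
    rw [hdec]
    exact mul_mem (hI u hu).2 (betaR_mem_Kr hβ')
  refine hU.isStarReps ?_ ?_ ?_
  · intro u hu
    refine ⟨hK u hu, fun h => betaR_not_mem' hβ' ?_⟩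
    have h1 := h.1
    rw [hdec] at h1
    exact ((S.Kr r).mul_mem_cancel_left (hI u hu).1).mp h1
  · intro k hk hkI
    have h02 : S.mat k 0 2 ∉ S.pE (-r) := fun h => hkI ⟨mem_Kr_of_mem_succ hk h, hk⟩
    obtain ⟨b0, b1, b2⟩ := betaR_mul_apply (r := r) (S.mat k)
    rw [← hβ, ← mat_mul] at b0 b1 b2
    have hc : S.mat (β * k) 2 2 ∉ S.pE (-1 + 1) := by
      rw [b2, zpow_mul_mem_pE_iff]
      simpa using h02
    have hc0 : S.mat (β * k) 2 2 ≠ 0 := fun h => hc (h ▸ zero_mem_pE _)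
    obtain ⟨x, y, hxy, hyc, h0, hinv⟩ := exists_unipotent_clearing (col_form (β * k) 2 2) hc0
    have hu : S.nE x y hxy ∈ S.Nsub (-r + 1) := by
      rw [mem_Nsub_iff (mat_nE hxy) hxy]
      refine mem_pE_of_mul hc ?_
      rw [hyc, b0, zpow_mul_mem_pE_iff]
      exact pE_mono (by omega) (mem_Kr_iff.mp hk).2.2.2.2
    refine ⟨_, hu, ?_⟩
    have hmem := mul_mem (inv_mem (hK _ hu)) hk
    refine ⟨mem_Kr_of_mem_succ hmem ?_, hmem⟩
    have e : (β * S.nE x y hxy * S.alphaE⁻¹)⁻¹ * k =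
        S.alphaE * ((S.nE x y hxy)⁻¹ * (β * k)) := by
      simp only [mul_inv_rev, inv_inv, betaR_inv hβ, mul_assoc]
    have h1 : S.mat ((S.nE x y hxy)⁻¹ * (β * k)) 0 2 = 0 := by
      rw [mat_mul_apply, hinv]
      exact h0
    rw [e, mat_mul_apply, h1, mat_alpha]
    simp [alphaM, zero_mem_pE]
  · intro u hu v hv
    have hw := mul_mem (inv_mem hu) hv
    have e : (β * u * S.alphaE⁻¹)⁻¹ * (β * v * S.alphaE⁻¹) =
        S.alphaE * (u⁻¹ * v) * S.alphaE⁻¹ := by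
      simp [mul_inv_rev, mul_assoc]
    rw [← alpha_conj_mem_iff hw, e, Subgroup.mem_inf]
    refine and_iff_left ?_
    rw [← e]
    exact mul_mem (inv_mem (hK u hu)) (hK v hv)

end Star
end Setting
end U21

namespace U21
namespace Setting

variable {S : Setting}

section Level

/-- The first column of `g⁻¹` lies in the `k`-th member of the lattice chain attached to `K_r`. -/
def InLat (r k : ℤ) (g : S.GG) : Prop :=
  S.mat g⁻¹ 0 0 ∈ S.fil (2 * k) ∧ S.mat g⁻¹ 1 0 ∈ S.fil (r + 2 * k) ∧
    S.mat g⁻¹ 2 0 ∈ S.fil (2 * r + 2 * k)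

variable {r k : ℤ} {g : S.GG}

lemma InLat.anti {j : ℤ} (h : InLat r k g) (hjk : j ≤ k) : InLat r j g :=
  ⟨fil_mono (by omega) h.1, fil_mono (by omega) h.2.1, fil_mono (by omega) h.2.2⟩

lemma InLat.of_succ (h : InLat (r + 1) k g) : InLat r k g :=
  ⟨h.1, fil_mono (by omega) h.2.1, fil_mono (by omega) h.2.2⟩

lemma InLat.succ (h : InLat r (k + 1) g) : InLat (r + 1) k g :=
  ⟨fil_mono (by omega) h.1, fil_mono (by omega) h.2.1, fil_mono (by omega) h.2.2⟩

lemma InLat.mul {κ : S.GG} (h : InLat r k g) (hκ : κ ∈ S.Kr r) : InLat r k (g * κ) := by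
  obtain ⟨⟨h00, h01, h02⟩, ⟨h10, h11, h12⟩, h20, h21, h22⟩ := mem_Kr_iff.mp (inv_mem hκ)
  obtain ⟨g0, g1, g2⟩ := h
  simp only [InLat, mul_inv_rev, mat_mul_apply κ⁻¹]
  refine ⟨add_mem (add_mem ?_ ?_) ?_, add_mem (add_mem ?_ ?_) ?_, add_mem (add_mem ?_ ?_) ?_⟩
  · exact fil_mul' (by omega) h00 g0
  · exact fil_mul' (by omega) h01 g1
  · exact fil_mul' (by omega) h02 g2
  · exact fil_mul' (by omega) h10 g0
  · exact fil_mul' (by omega) h11 g1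
  · exact fil_mul' (by omega) h12 g2
  · exact fil_mul' (by omega) h20 g0
  · exact fil_mul' (by omega) h21 g1
  · exact fil_mul' (by omega) h22 g2

lemma exists_level (r : ℤ) (g : S.GG) : ∃ m : ℤ, ∀ k, InLat r k g ↔ k ≤ m := by
  obtain ⟨k0, h0⟩ := exists_mem_pE (S.mat g⁻¹ 0 0)
  obtain ⟨k1, h1⟩ := exists_mem_pE (S.mat g⁻¹ 1 0)
  obtain ⟨k2, h2⟩ := exists_mem_pE (S.mat g⁻¹ 2 0)
  have hin : ∃ k, InLat r k g := by
    refine ⟨-(|k0| + |k1| + |k2| + |r|), pE_mono ?_ h0, pE_mono ?_ h1, pE_mono ?_ h2⟩ <;>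
    · have := neg_abs_le k0
      have := neg_abs_le k1
      have := neg_abs_le k2
      have := le_abs_self r
      have := abs_nonneg k0
      have := abs_nonneg k1
      have := abs_nonneg k2
      have := abs_nonneg r
      omega
  have hbd : ∃ b, ∀ k, InLat r k g → k ≤ b := by
    have hne : S.mat g⁻¹ 0 0 ≠ 0 ∨ S.mat g⁻¹ 2 0 ≠ 0 := by
      by_contra! hc
      have h := col_form g⁻¹ 0 2
      have h' := col_form g⁻¹ 0 0
      rw [hc.1, hc.2] at h h'
      have h1 : S.mat g⁻¹ 1 0 = 0 := by simpa [betaM] using h'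
      rw [h1] at h
      simp [betaM] at h
    rcases hne with h | h <;> obtain ⟨b, hb⟩ := exists_not_mem_pE h
    · refine ⟨b, fun k hk => ?_⟩
      by_contra! hlt
      exact hb (pE_mono (by omega) hk.1)
    · refine ⟨b - r, fun k hk => ?_⟩
      by_contra! hlt
      exact hb (pE_mono (by omega) hk.2.2)
  obtain ⟨m, hm, hmax⟩ := Int.exists_greatest_of_bdd hbd hin
  exact ⟨m, fun k => ⟨hmax k, fun hk => hm.anti hk⟩⟩

/-- The position of `g` in the lattice chain attached to `K_r`. -/
def level (r : ℤ) (g : S.GG) : ℤ := (exists_level r g).choose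

lemma inLat_iff : InLat r k g ↔ k ≤ level r g := (exists_level r g).choose_spec k

lemma level_mul {κ : S.GG} (hκ : κ ∈ S.Kr r) : level r (g * κ) = level r g := by
  refine le_antisymm (inLat_iff.mp ?_) (inLat_iff.mp ?_)
  · have := (inLat_iff.mpr (le_refl (level r (g * κ)))).mul (inv_mem hκ)
    rwa [mul_inv_cancel_right] at this
  · exact (inLat_iff.mpr le_rfl).mul hκ

lemma level_succ_le : level (r + 1) g ≤ level r g :=
  inLat_iff.mp (inLat_iff.mpr le_rfl).of_succ

lemma le_level_succ : level r g - 1 ≤ level (r + 1) g := by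
  refine inLat_iff.mp (InLat.succ (inLat_iff.mpr ?_))
  omega

lemma mem_Kr_succ_of_inLat {κ : S.GG} (hκ : κ ∈ S.Kr r) (hg : InLat (r + 1) k g)
    (hg' : ¬ InLat r (k + 1) g) (hκg : InLat (r + 1) k (g * κ⁻¹)) : κ ∈ S.Kr (r + 1) := by
  obtain ⟨⟨h00, h01, h02⟩, ⟨h10, h11, h12⟩, h20, h21, h22⟩ := mem_Kr_iff.mp hκ
  obtain ⟨g0, g1, g2⟩ := hg
  have hc0 : S.mat g⁻¹ 0 0 ∉ S.pE (k + 1) := by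
    intro h
    refine hg' ⟨pE_mono (by omega) h, ?_, fil_mono (by omega) g2⟩
    exact fil_mono (by omega)
      (fil_of_norm_eq (k := r + 2 * k + 2) (j := r + k + 1) (col_form g⁻¹ 0 0) (pE_mono (by omega) g2)
        (pE_mono (by omega) h))
  refine mem_Kr_succ_of_mem hκ (mem_pE_of_mul hc0 ?_)
  have h := hκg.2.2
  rw [mul_inv_rev, inv_inv, mat_mul_apply] at h
  have h' := sub_mem (sub_mem h (fil_mul' (l := 2 * (r + 1) + 2 * k) (by omega) h22 g2))
    (fil_mul' (l := 2 * (r + 1) + 2 * k) (by omega) h21 g1)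
  rw [add_sub_cancel_right, add_sub_cancel_right] at h'
  exact pE_mono (by omega) h'

lemma mem_Kr_of_inLat {κ : S.GG} (hκ : κ ∈ S.Kr (r + 1)) (hg : InLat r (k + 1) g)
    (hg' : ¬ InLat (r + 1) (k + 1) g) (hκg : InLat r (k + 1) (g * κ⁻¹)) : κ ∈ S.Kr r := by
  obtain ⟨⟨h00, h01, h02⟩, ⟨h10, h11, h12⟩, h20, h21, h22⟩ := mem_Kr_iff.mp hκ
  obtain ⟨g0, g1, g2⟩ := hg
  have hc2 : S.mat g⁻¹ 2 0 ∉ S.pE (r + k + 1 + 1) := by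
    intro h
    refine hg' ⟨g0, ?_, pE_mono (by omega) h⟩
    exact fil_mono (by omega)
      (fil_of_norm_eq (k := r + 2 * k + 3) (col_form g⁻¹ 0 0) h (pE_mono (by omega) g0))
  refine mem_Kr_of_mem_succ hκ (mem_pE_of_mul hc2 ?_)
  have h := hκg.1
  rw [mul_inv_rev, inv_inv, mat_mul_apply, add_assoc] at h
  have h' := sub_mem h (fil_mul' (l := 2 * (k + 1)) (by omega) h00 g0)
  rw [add_sub_cancel_left] at h'
  have h'' := sub_mem h' (fil_mul' (l := 2 * (k + 1)) (by omega) h01 g1)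
  rw [add_sub_cancel_left] at h''
  exact pE_mono (by omega) h''

/-- The height of a vertex `g K_r`. -/
def height (r : ℤ) : S.GG ⧸ S.Kr r → ℤ :=
  Quotient.lift (fun g => 2 * level r g) fun a b hab => by
    have h : a⁻¹ * b ∈ S.Kr r := QuotientGroup.leftRel_apply.mp hab
    have := level_mul (g := a) h
    rw [mul_inv_cancel_left] at this
    simp only [this]

lemma height_mk : height r (g : S.GG ⧸ S.Kr r) = 2 * level r g := rfl

lemma conj_mem_of_sub_one {κ z : S.GG} (hκ : κ ∈ S.Kr r)
    (hz : ∀ i j : Fin 3, S.mat z i j - (1 : S.M3) i j ∈ S.fil (r * ((i : ℕ) - (j : ℕ)) + 1)) :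
    κ * z * κ⁻¹ ∈ S.Kr r ⊓ S.Kr (r + 1) := by
  have hzK : z ∈ S.Kr r := by
    intro i j
    have h1 : (1 : S.M3) i j ∈ S.fil (r * ((i : ℕ) - (j : ℕ))) := (S.Kr r).one_mem i j
    simpa using add_mem (fil_mono (by omega) (hz i j)) h1
  have hc : κ * z * κ⁻¹ ∈ S.Kr r := mul_mem (mul_mem hκ hzK) (inv_mem hκ)
  refine ⟨hc, mem_Kr_succ_of_mem hc ?_⟩
  have h20 : S.mat (κ * z * κ⁻¹) 2 0 =
      ∑ i, ∑ j, S.mat κ 2 i * (S.mat z i j - (1 : S.M3) i j) * S.mat κ⁻¹ j 0 := by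
    have h : S.mat κ * S.mat κ⁻¹ = 1 := by rw [← mat_mul, mul_inv_cancel, mat_one]
    have e : S.mat (κ * z * κ⁻¹) = S.mat κ * (S.mat z - 1) * S.mat κ⁻¹ + 1 := by
      rw [mat_mul, mat_mul, Matrix.mul_sub, Matrix.sub_mul, Matrix.mul_one, h, sub_add_cancel]
    rw [e, Matrix.add_apply, Matrix.mul_apply, Finset.sum_comm]
    simp only [Matrix.mul_apply, Finset.sum_mul, Matrix.sub_apply]
    simp
  have h : S.mat (κ * z * κ⁻¹) 2 0 ∈ S.fil (2 * r + 1) := by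
    rw [h20]
    refine sum_mem fun i _ => sum_mem fun j _ => ?_
    refine fil_mul' ?_ (fil_mul (hκ 2 i) (hz i j)) (inv_mem hκ j 0)
    have e : r * (((2 : Fin 3) : ℕ) - (i : ℕ)) + (r * ((i : ℕ) - (j : ℕ)) + 1) +
        r * ((j : ℕ) - ((0 : Fin 3) : ℕ)) = 2 * r + 1 := by
      simp
      ring
    rw [e]
  exact pE_mono (by omega) h

lemma IsStarReps.three_edges {G : Type*} [Group G] {K I : Subgroup G} (hIK : I ≤ K) {U : Finset G}
    {γ : G → G} (h : IsStarReps K I U γ) (hU : 2 ≤ U.card) (x : G ⧸ K) :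
    ∃ e₁ e₂ e₃, Subgroup.quotientMapOfLE hIK e₁ = x ∧ Subgroup.quotientMapOfLE hIK e₂ = x ∧
      Subgroup.quotientMapOfLE hIK e₃ = x ∧ e₁ ≠ e₂ ∧ e₁ ≠ e₃ ∧ e₂ ≠ e₃ := by
  induction x using QuotientGroup.induction_on with
  | H g =>
  obtain ⟨u, hu, v, hv, huv⟩ := Finset.one_lt_card.mp hU
  have hK : ∀ w ∈ U, Subgroup.quotientMapOfLE hIK ((g * γ w : G) : G ⧸ I) = (g : G ⧸ K) :=
    fun w hw => QuotientGroup.mk_mul_of_mem _ (h.1 w hw).1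
  have hI : ∀ w ∈ U, (g : G ⧸ I) ≠ ((g * γ w : G) : G ⧸ I) := by
    intro w hw heq
    rw [QuotientGroup.eq, inv_mul_cancel_left] at heq
    exact (h.1 w hw).2 heq
  refine ⟨(g : G ⧸ I), ((g * γ u : G) : G ⧸ I), ((g * γ v : G) : G ⧸ I), rfl, hK u hu, hK v hv,
    hI u hu, hI v hv, fun heq => huv ?_⟩
  rw [QuotientGroup.eq, mul_inv_rev, mul_assoc, inv_mul_cancel_left] at heq
  exact (h.2 _ (h.1 v hv).1 (h.1 v hv).2).unique ⟨hu, heq⟩ ⟨hv, by simp [one_mem]⟩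

lemma isHeight_Kr {U : Finset S.GG} {γ : S.GG → S.GG}
    (h : IsStarReps (S.Kr r) (S.Kr r ⊓ S.Kr (r + 1)) U γ) (hU : 2 ≤ U.card) :
    IsHeight (Subgroup.quotientMapOfLE (inf_le_left : S.Kr r ⊓ S.Kr (r + 1) ≤ S.Kr r))
      (Subgroup.quotientMapOfLE (inf_le_right : S.Kr r ⊓ S.Kr (r + 1) ≤ S.Kr (r + 1)))
      (height r) (fun y => height (r + 1) y + 1) where
  ne e := by
    induction e using QuotientGroup.induction_on with
    | H g =>
    rw [Subgroup.quotientMapOfLE_apply_mk, Subgroup.quotientMapOfLE_apply_mk, height_mk, height_mk]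
    omega
  uniq e e' := by
    induction e using QuotientGroup.induction_on with
    | H g =>
    induction e' using QuotientGroup.induction_on with
    | H g' =>
    simp only [Subgroup.quotientMapOfLE_apply_mk, height_mk]
    intro heq h1 h2
    have hK := inv_mem (QuotientGroup.eq.mp heq)
    rw [QuotientGroup.eq]
    have hl := level_mul (g := g) (inv_mem hK)
    rw [inv_inv, mul_inv_cancel_left] at hl
    have := le_level_succ (r := r) (g := g)
    refine inv_mem_iff.mp ⟨mem_Kr_of_inLat (k := level (r + 1) g) hK (g := g) (inLat_iff.mpr ?_)
      (fun h => ?_) (inLat_iff.mpr ?_), hK⟩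
    · omega
    · have := inLat_iff.mp h
      omega
    · rw [inv_inv, mul_inv_cancel_left]
      omega
  uniq' e e' := by
    induction e using QuotientGroup.induction_on with
    | H g =>
    induction e' using QuotientGroup.induction_on with
    | H g' =>
    simp only [Subgroup.quotientMapOfLE_apply_mk, height_mk]
    intro heq h1 h2
    have hK := inv_mem (QuotientGroup.eq.mp heq)
    rw [QuotientGroup.eq]
    have hl := level_mul (g := g) (inv_mem hK)
    rw [inv_inv, mul_inv_cancel_left] at hl
    have := level_succ_le (r := r) (g := g)
    refine inv_mem_iff.mp ⟨hK, mem_Kr_succ_of_inLat (k := level r g) hK (g := g) (inLat_iff.mpr ?_)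
      (fun h => ?_) (inLat_iff.mpr ?_)⟩
    · omega
    · have := inLat_iff.mp h
      omega
    · rw [inv_inv, mul_inv_cancel_left]
      omega
  three := IsStarReps.three_edges inf_le_left h hU

end Level
end Setting

/-- The geometry of the two vertices of the edge stabilised by the Iwahori subgroup `I_K`:
`K'` is the maximal compact subgroup not conjugate to `K` with `I_K = K ∩ K'`. -/
structure TreeData {S : Setting} (C : Chamber S) where
  K' : Subgroup S.GG
  U0 : Finset S.GG
  U1 : Finset S.GG
  hX : S.GG ⧸ C.K → ℤ
  hY : S.GG ⧸ K' → ℤ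
  I1_le : C.I1 ⊆ (C.K ⊓ K' : Subgroup S.GG)
  Kone_conj_mem : ∀ k ∈ C.K, ∀ z ∈ C.KoneS, k * z * k⁻¹ ∈ C.K ⊓ K'
  H0_le : C.H0 ⊆ (C.K ⊓ K' : Subgroup S.GG)
  beta_mem : C.βK ∈ C.K
  beta_not_mem : C.βK ∉ K'
  beta_mul_beta : C.βK * C.βK = 1
  U0_subset : (U0 : Set S.GG) ⊆ (C.K ⊓ K' : Subgroup S.GG)
  U1_subset : (U1 : Set S.GG) ⊆ (C.K ⊓ K' : Subgroup S.GG)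
  beta_conj_mem : ∀ u ∈ U0, C.βK * u * C.βK ∈ C.I1'
  p_dvd_card_U0 : S.p ∣ U0.card
  p_dvd_card_U1 : S.p ∣ U1.card
  injOn_mul : Set.InjOn (fun p : S.GG × S.GG => p.1 * p.2) (U0 ×ˢ U1 : Finset (S.GG × S.GG))
  isReps_mul : S.IsReps (S.Nk C.nK) (S.Nk (C.nK + 2)) ((U0 ×ˢ U1).image fun p => p.1 * p.2)
  isReps_U1 : S.IsReps (S.Nk (C.nK + 1)) (S.Nk (C.nK + 2)) U1
  isStarReps_K : IsStarReps C.K (C.K ⊓ K') U0 fun u => u * C.βK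
  isStarReps_K' : IsStarReps K' (C.K ⊓ K') U1 fun u => C.βK * u * S.alphaE⁻¹
  isHeight : IsHeight (Subgroup.quotientMapOfLE (inf_le_left : C.K ⊓ K' ≤ C.K))
    (Subgroup.quotientMapOfLE (inf_le_right : C.K ⊓ K' ≤ K')) hX hY
  isHeight' : IsHeight (Subgroup.quotientMapOfLE (inf_le_right : C.K ⊓ K' ≤ K'))
    (Subgroup.quotientMapOfLE (inf_le_left : C.K ⊓ K' ≤ C.K)) hY hX

namespace Chamber

variable {S : Setting} (C : Chamber S)

/-- A uniform description of the two chambers. -/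
lemma exists_parameter : ∃ r : ℤ, C.K = S.Kr r ∧ C.nK = -r ∧ S.mat C.βK = S.betaR r ∧
    C.I1 ⊆ C.IK ∧ C.IK ⊆ (S.Kr r ⊓ S.Kr (r + 1) : Subgroup S.GG) ∧
    (∀ z ∈ C.KoneS, ∀ i j : Fin 3,
      S.mat z i j - (1 : S.M3) i j ∈ S.fil (r * ((i : ℕ) - (j : ℕ)) + 1)) ∧
    ∀ g x y, g ∈ C.K → S.mat g = S.n'M x y → g ∈ C.I1' := by
  have hz : ∀ k, (0 : S.E) ∈ S.pE k := Setting.zero_mem_pE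
  rcases C.cases with ⟨hK, hone, hIK, hI1, hI1', hβ, hn, -⟩ | ⟨hK, hone, hIK, hI1, hI1', hβ, hn, -⟩
  · have hK' : C.K = S.Kr 0 := by
      apply SetLike.coe_injective
      rw [hK]
      ext g
      rw [SetLike.mem_coe, Setting.mem_Kr_iff]
      simp [Setting.K0set, Fin.forall_fin_succ, Setting.mem_fil, Setting.mem_pE_zero]
    refine ⟨0, hK', by simpa using hn, ?_, ?_, ?_, ?_, ?_⟩
    · rw [hβ]
      ext i j
      fin_cases i <;> fin_cases j <;> simp [Setting.betaR] <;> rfl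
    · rw [hI1, hIK]
      exact fun g hg => hg.1
    · rw [hIK]
      rintro g ⟨hg, h1, h2, h3⟩
      have hgK : g ∈ S.Kr 0 := by rw [← hK', ← SetLike.mem_coe, hK]; exact hg
      exact ⟨hgK, Setting.mem_Kr_succ_of_mem hgK h2⟩
    · rw [hone]
      intro z hz i j
      simpa [Setting.mem_fil] using hz i j
    · intro g x y hg hm
      rw [hI1']
      rw [← SetLike.mem_coe, hK] at hg
      refine ⟨hg, ?_⟩
      rw [hm]
      simp [Setting.n'M, hz]
  · have hK' : C.K = S.Kr 1 := by
      apply SetLike.coe_injective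
      rw [hK]
      ext g
      rw [SetLike.mem_coe, Setting.mem_Kr_iff]
      simp only [Setting.K1set, Setting.mem_fil, Set.mem_ofPred_eq, ← Setting.mem_pE_zero]
      norm_num
      tauto
    refine ⟨1, hK', by simpa using hn, ?_, ?_, ?_, ?_, ?_⟩
    · rw [hβ, Setting.betaPr]
      refine (Setting.mat_beta_mul_alpha_inv (r := 0) ?_).trans (by norm_num)
      ext i j
      fin_cases i <;> fin_cases j <;> simp [Setting.betaR] <;> rfl
    · rw [hI1, hIK]
      exact fun g hg => hg.1
    · rw [hIK]
      rintro g ⟨hg, h2⟩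
      have hgK : g ∈ S.Kr 1 := by rw [← hK', ← SetLike.mem_coe, hK]; exact hg
      exact ⟨hgK, Setting.mem_Kr_succ_of_mem hgK h2⟩
    · rw [hone]
      rintro z ⟨⟨-, h01, -, h10, -, h12, -, h21, -⟩, h02, h20, h00, h11, h22⟩
      rw [← Setting.mem_pE_zero] at h01 h12 h02
      intro i j
      rw [Setting.mem_fil]
      fin_cases i <;> fin_cases j <;> simpa
    · intro g x y hg hm
      rw [hI1']
      rw [← SetLike.mem_coe, hK] at hg
      refine ⟨hg, ?_⟩
      rw [hm]
      simp [Setting.n'M, hz]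

lemma exists_treeData : Nonempty (TreeData C) := by
  obtain ⟨r, hK, hn, hβ, hI1, hIK, hone, hI1'⟩ := C.exists_parameter
  have hfin := Setting.finite_Nsub_quotient (S := S)
  have := hfin (-r)
  obtain ⟨U0, hU0, hc0⟩ := Setting.exists_isReps (A := S.Nsub (-r)) (B := S.Nsub (-r + 1))
  have := hfin (-r + 1)
  obtain ⟨U1, hU1, hc1⟩ := Setting.exists_isReps (A := S.Nsub (-r + 1)) (B := S.Nsub (-r + 1 + 1))
  have hd0 : S.p ∣ U0.card := hc0 ▸ Setting.p_dvd_card_Nsub_quotient _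
  have hd1 : S.p ∣ U1.card := hc1 ▸ Setting.p_dvd_card_Nsub_quotient _
  have h20 : 2 ≤ U0.card := S.hp.two_le.trans (Nat.le_of_dvd (hc0 ▸ Nat.card_pos) hd0)
  have h21 : 2 ≤ U1.card := S.hp.two_le.trans (Nat.le_of_dvd (hc1 ▸ Nat.card_pos) hd1)
  have e : -r + 1 + 1 = -r + 2 := by ring
  rw [e] at hU1
  have hs0 := Setting.isStarReps_Kr hβ hU0
  have hs1 := Setting.isStarReps_Kr_succ hβ hU1
  have hh := Setting.isHeight_Kr hs0 h20
  obtain ⟨K, KoneS, IK, I1, I1', βK, nK, mK, tK, hcases⟩ := C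
  simp only at hK hn hβ hI1 hIK hone hI1'
  subst hK hn
  refine ⟨{
    K' := S.Kr (r + 1)
    U0 := U0
    U1 := U1
    hX := Setting.height r
    hY := fun y => Setting.height (r + 1) y + 1
    I1_le := hI1.trans hIK
    Kone_conj_mem := fun k hk z hz => Setting.conj_mem_of_sub_one hk (hone z hz)
    H0_le := fun h hh => hIK hh.2
    beta_mem := Setting.betaR_mem_Kr hβ
    beta_not_mem := Setting.betaR_not_mem hβ
    beta_mul_beta := Setting.betaR_mul_self hβ
    U0_subset := fun u hu => Setting.Nsub_le_inf (hU0.1 hu)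
    U1_subset := fun u hu => Setting.Nsub_le_inf (Setting.Nsub_mono (by omega) (hU1.1 hu))
    beta_conj_mem := ?_
    p_dvd_card_U0 := hd0
    p_dvd_card_U1 := hd1
    injOn_mul := hU0.injOn_mul hU1
    isReps_mul := hU0.mul hU1 (Setting.Nsub_mono (by omega)) (Setting.Nsub_mono (by omega))
    isReps_U1 := hU1
    isStarReps_K := hs0
    isStarReps_K' := hs1
    isHeight := hh
    isHeight' := ⟨fun e => (hh.ne e).symm, hh.uniq', hh.uniq,
      Setting.IsStarReps.three_edges inf_le_right hs1 h21⟩ }⟩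
  intro u hu
  obtain ⟨x, y, hxy, hy, hm⟩ := hU0.1 hu
  have hb := Setting.betaR_mem_Kr hβ
  exact hI1' _ _ _ (mul_mem (mul_mem hb (Setting.Nsub_le_Kr le_rfl (hU0.1 hu))) hb)
    (Setting.mat_beta_conj hβ hm)

end Chamber
end U21

namespace U21

section CompactInduction

variable {S : Setting} {C : Chamber S} {𝔽 : Type} [Field 𝔽]
variable {W : Type} [AddCommGroup W] [Module 𝔽 W] (σ : Representation 𝔽 ↥C.K W)

lemma not_quotientIrreducible {V : Type} [AddCommGroup V] [Module 𝔽 V]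
    {ρ : Representation 𝔽 S.GG V} {N P : Submodule 𝔽 V} (hP : Invt 𝔽 ρ P) (hle : N ≤ P)
    (hne : P ≠ N) (htop : P ≠ ⊤) : ¬ QuotientIrreducible 𝔽 ρ N :=
  fun h => (h.2 P hP hle).elim hne htop

lemma sigma'_of_mem {g : S.GG} (hg : g ∈ C.K) : sigma' C 𝔽 W σ g = σ ⟨g, hg⟩ := dif_pos hg

lemma sigma'_mul {g h : S.GG} (hg : g ∈ C.K) (hh : h ∈ C.K) :
    sigma' C 𝔽 W σ (g * h) = sigma' C 𝔽 W σ g * sigma' C 𝔽 W σ h := by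
  rw [sigma'_of_mem σ hg, sigma'_of_mem σ hh, sigma'_of_mem σ (mul_mem hg hh), ← map_mul]
  rfl

lemma stdFn_apply (g : S.GG) (v : W) (x : S.GG) :
    stdFn C 𝔽 W σ g v x = if x * g ∈ C.K then sigma' C 𝔽 W σ (x * g) v else 0 := by
  unfold stdFn
  split_ifs with h
  · rw [sigma'_of_mem σ h]
  · rfl

lemma stdFn_mem (g : S.GG) (v : W) : stdFn C 𝔽 W σ g v ∈ IndSub C 𝔽 W σ := by
  refine ⟨fun k hk x => ?_, {g⁻¹}, fun x hx => ?_⟩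
  · rw [stdFn_apply, stdFn_apply, mul_assoc, mul_mem_cancel_left hk]
    split_ifs with h
    · rw [sigma'_mul σ hk h, sigma'_of_mem σ hk]
      rfl
    · rw [map_zero]
  · rw [stdFn_apply, ne_eq, ite_eq_right_iff, Classical.not_imp] at hx
    exact ⟨x * g, hx.1, g⁻¹, by simp, by simp⟩

/-- The element `[g, v]` of the compact induction. -/
def std (g : S.GG) (v : W) : IndSub C 𝔽 W σ := ⟨stdFn C 𝔽 W σ g v, stdFn_mem σ g v⟩

lemma std_apply (g : S.GG) (v : W) (x : S.GG) :
    (std σ g v : S.GG → W) x = if x * g ∈ C.K then sigma' C 𝔽 W σ (x * g) v else 0 :=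
  stdFn_apply σ g v x

lemma indRep_std (h g : S.GG) (v : W) : indRep C 𝔽 W σ h (std σ g v) = std σ (h * g) v := by
  ext x
  change (std σ g v : S.GG → W) (x * h) = _
  rw [std_apply, std_apply, mul_assoc]

lemma std_mul (g : S.GG) {k : S.GG} (hk : k ∈ C.K) (v : W) :
    std σ (g * k) v = std σ g (sigma' C 𝔽 W σ k v) := by
  ext x
  rw [std_apply, std_apply, ← mul_assoc, mul_mem_cancel_right hk]
  split_ifs with h
  · rw [sigma'_mul σ h hk]
    rfl
  · rfl

/-- `v ↦ [g, v]` as a linear map. -/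
def stdHom (g : S.GG) : W →ₗ[𝔽] IndSub C 𝔽 W σ where
  toFun := std σ g
  map_add' v w := by
    ext x
    change _ = (std σ g v : S.GG → W) x + (std σ g w : S.GG → W) x
    simp only [std_apply]
    split_ifs <;> simp
  map_smul' c v := by
    ext x
    change _ = c • (std σ g v : S.GG → W) x
    simp only [std_apply]
    split_ifs <;> simp

lemma eq_top_of_std_mem {P : Submodule 𝔽 (IndSub C 𝔽 W σ)} (h : ∀ g v, std σ g v ∈ P) :
    P = ⊤ := by
  rw [eq_top_iff]
  rintro ⟨f, hf⟩ -
  obtain ⟨s, hs⟩ := hf.2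
  induction s using Finset.induction_on generalizing f with
  | empty =>
    have : f = 0 := by
      funext g
      by_contra hg
      obtain ⟨k, -, t, ht, -⟩ := hs g hg
      exact absurd ht (Finset.notMem_empty t)
    subst this
    exact P.zero_mem
  | insert t s _ ih =>
    have hsub := (IndSub C 𝔽 W σ).sub_mem hf (stdFn_mem σ t⁻¹ (f t))
    have hmem := ih _ hsub fun g hg => ?_
    · have := P.add_mem hmem (h t⁻¹ (f t))
      convert this using 1
      ext x
      exact (sub_add_cancel (f x) (stdFn C 𝔽 W σ t⁻¹ (f t) x)).symm
    · rw [Pi.sub_apply, stdFn_apply] at hg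
      by_cases hK : g * t⁻¹ ∈ C.K
      · have hft := hf.1 _ hK t
        rw [inv_mul_cancel_right] at hft
        rw [if_pos hK, sigma'_of_mem σ hK, hft, sub_self] at hg
        exact absurd rfl hg
      · rw [if_neg hK, sub_zero] at hg
        obtain ⟨k, hk, t', ht', rfl⟩ := hs g hg
        rcases Finset.mem_insert.mp ht' with rfl | ht'
        · exact absurd (by simpa using hk) hK
        · exact ⟨k, hk, t', ht', rfl⟩

variable {J : Subgroup S.GG} {v₀ : W}

/-- The map `𝔽[G/J] → ind_K^G σ` sending `gJ` to `[g, v₀]`, for a `J`-fixed vector `v₀`. -/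
def cosetMap (hJ : J ≤ C.K) (hv : ∀ j ∈ J, sigma' C 𝔽 W σ j v₀ = v₀) :
    (S.GG ⧸ J →₀ 𝔽) →ₗ[𝔽] IndSub C 𝔽 W σ :=
  Finsupp.linearCombination 𝔽 (Quotient.lift (fun g => std σ g v₀) fun g h hgh => by
    have h1 : g⁻¹ * h ∈ J := QuotientGroup.leftRel_apply.mp hgh
    have h2 := std_mul σ g (hJ h1) v₀
    rw [hv _ h1, mul_inv_cancel_left] at h2
    exact h2.symm)

variable {σ} (hJ : J ≤ C.K) (hv : ∀ j ∈ J, sigma' C 𝔽 W σ j v₀ = v₀)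

lemma cosetMap_single (g : S.GG) (r : 𝔽) :
    cosetMap σ hJ hv (Finsupp.single (g : S.GG ⧸ J) r) = r • std σ g v₀ :=
  Finsupp.linearCombination_single _ _ _

lemma indRep_cosetMap (h : S.GG) (c : S.GG ⧸ J →₀ 𝔽) :
    indRep C 𝔽 W σ h (cosetMap σ hJ hv c) = cosetMap σ hJ hv (c.mapDomain (h • ·)) := by
  induction c using Finsupp.induction_linear with
  | zero => simp
  | add f g hf hg => rw [map_add, map_add, hf, hg, Finsupp.mapDomain_add, map_add]
  | single e r =>
    induction e using QuotientGroup.induction_on with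
    | H g =>
    rw [Finsupp.mapDomain_single, MulAction.Quotient.smul_coe, smul_eq_mul, cosetMap_single,
      cosetMap_single, map_smul, indRep_std]

end CompactInduction

section Equivariance

variable {G : Type*} [Group G] {𝔽 : Type*} [Field 𝔽] {K I : Subgroup G}

lemma mapDomain_quotientMapOfLE_smul (hIK : I ≤ K) (h : G) (c : G ⧸ I →₀ 𝔽) :
    (c.mapDomain (h • ·)).mapDomain (Subgroup.quotientMapOfLE hIK) =
      (c.mapDomain (Subgroup.quotientMapOfLE hIK)).mapDomain (h • ·) := by
  rw [← Finsupp.mapDomain_comp, ← Finsupp.mapDomain_comp]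
  congr 1
  funext x
  induction x using QuotientGroup.induction_on
  rfl

lemma IsStarReps.pull_smul {U : Finset G} {γ : G → G} (hIK : I ≤ K) (hU : IsStarReps K I U γ)
    (hfin : ∀ x, (Subgroup.quotientMapOfLE hIK ⁻¹' {x}).Finite) (h : G) (c : G ⧸ K →₀ 𝔽) :
    pull 𝔽 (Subgroup.quotientMapOfLE hIK) hfin (c.mapDomain (h • ·)) =
      (pull 𝔽 (Subgroup.quotientMapOfLE hIK) hfin c).mapDomain (h • ·) := by
  suffices pull 𝔽 (Subgroup.quotientMapOfLE hIK) hfin ∘ₗ Finsupp.lmapDomain 𝔽 𝔽 (h • ·) =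
      Finsupp.lmapDomain 𝔽 𝔽 (h • ·) ∘ₗ pull 𝔽 (Subgroup.quotientMapOfLE hIK) hfin from
    LinearMap.congr_fun this c
  refine Finsupp.lhom_ext' fun x => LinearMap.ext_ring ?_
  induction x using QuotientGroup.induction_on with
  | H g =>
  simp only [LinearMap.comp_apply, Finsupp.lsingle_apply, Finsupp.lmapDomain_apply,
    Finsupp.mapDomain_single, MulAction.Quotient.smul_coe, smul_eq_mul]
  rw [hU.pull_single hIK hfin, hU.pull_single hIK hfin, Finsupp.mapDomain_add,
    Finsupp.mapDomain_finsetSum]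
  simp only [Finsupp.mapDomain_single, MulAction.Quotient.smul_coe, smul_eq_mul, mul_assoc]

end Equivariance

namespace TreeData

variable {S : Setting} {C : Chamber S} (D : TreeData C) (𝔽 : Type) [Field 𝔽]

/-- The Iwahori subgroup, as the stabiliser of an edge. -/
abbrev I : Subgroup S.GG := C.K ⊓ D.K'

abbrev qX : S.GG ⧸ D.I → S.GG ⧸ C.K := Subgroup.quotientMapOfLE inf_le_left
abbrev qY : S.GG ⧸ D.I → S.GG ⧸ D.K' := Subgroup.quotientMapOfLE inf_le_right

lemma finX (x : S.GG ⧸ C.K) : (D.qX ⁻¹' {x}).Finite := D.isStarReps_K.finite_fiber inf_le_left x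
lemma finY (y : S.GG ⧸ D.K') : (D.qY ⁻¹' {y}).Finite := D.isStarReps_K'.finite_fiber inf_le_right y

abbrev pX : (S.GG ⧸ D.I →₀ 𝔽) →ₗ[𝔽] (S.GG ⧸ C.K →₀ 𝔽) := Finsupp.lmapDomain 𝔽 𝔽 D.qX
abbrev pY : (S.GG ⧸ D.I →₀ 𝔽) →ₗ[𝔽] (S.GG ⧸ D.K' →₀ 𝔽) := Finsupp.lmapDomain 𝔽 𝔽 D.qY
abbrev iX : (S.GG ⧸ C.K →₀ 𝔽) →ₗ[𝔽] (S.GG ⧸ D.I →₀ 𝔽) := pull 𝔽 D.qX D.finX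
abbrev iY : (S.GG ⧸ D.K' →₀ 𝔽) →ₗ[𝔽] (S.GG ⧸ D.I →₀ 𝔽) := pull 𝔽 D.qY D.finY

variable {𝔽}

lemma card_U0 (hp : (S.p : 𝔽) = 0) : (D.U0.card : 𝔽) = 0 := by
  obtain ⟨m, hm⟩ := D.p_dvd_card_U0
  rw [hm, Nat.cast_mul, hp, zero_mul]

lemma card_U1 (hp : (S.p : 𝔽) = 0) : (D.U1.card : 𝔽) = 0 := by
  obtain ⟨m, hm⟩ := D.p_dvd_card_U1
  rw [hm, Nat.cast_mul, hp, zero_mul]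

lemma pX_iX (hp : (S.p : 𝔽) = 0) (f : S.GG ⧸ C.K →₀ 𝔽) : D.pX 𝔽 (D.iX 𝔽 f) = f :=
  D.isStarReps_K.push_pull inf_le_left D.finX (D.card_U0 hp) f

lemma pY_iY (hp : (S.p : 𝔽) = 0) (f : S.GG ⧸ D.K' →₀ 𝔽) : D.pY 𝔽 (D.iY 𝔽 f) = f :=
  D.isStarReps_K'.push_pull inf_le_right D.finY (D.card_U1 hp) f

lemma pX_single (g : S.GG) : D.pX 𝔽 (Finsupp.single (g : S.GG ⧸ D.I) 1) =
    Finsupp.single (g : S.GG ⧸ C.K) 1 := Finsupp.mapDomain_single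

lemma pY_single (g : S.GG) : D.pY 𝔽 (Finsupp.single (g : S.GG ⧸ D.I) 1) =
    Finsupp.single (g : S.GG ⧸ D.K') 1 := Finsupp.mapDomain_single

lemma iX_single (g : S.GG) : D.iX 𝔽 (Finsupp.single (g : S.GG ⧸ C.K) 1) =
    Finsupp.single (g : S.GG ⧸ D.I) 1 +
      ∑ u ∈ D.U0, Finsupp.single ((g * (u * C.βK) : S.GG) : S.GG ⧸ D.I) 1 :=
  D.isStarReps_K.pull_single inf_le_left D.finX g

lemma iY_single (g : S.GG) : D.iY 𝔽 (Finsupp.single (g : S.GG ⧸ D.K') 1) =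
    Finsupp.single (g : S.GG ⧸ D.I) 1 +
      ∑ u ∈ D.U1, Finsupp.single ((g * (C.βK * u * S.alphaE⁻¹) : S.GG) : S.GG ⧸ D.I) 1 :=
  D.isStarReps_K'.pull_single inf_le_right D.finY g

lemma pY_iX_ne_single (f : S.GG ⧸ C.K →₀ 𝔽) (y : S.GG ⧸ D.K') :
    D.pY 𝔽 (D.iX 𝔽 f) ≠ Finsupp.single y 1 :=
  D.isHeight.spread_ne_single D.finX D.finY f y

lemma pX_iY_ne_single (f : S.GG ⧸ D.K' →₀ 𝔽) (x : S.GG ⧸ C.K) :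
    D.pX 𝔽 (D.iY 𝔽 f) ≠ Finsupp.single x 1 :=
  D.isHeight'.spread_ne_single D.finY D.finX f x

lemma eq_zero_of_pY_iX {f : S.GG ⧸ C.K →₀ 𝔽} (h : D.pY 𝔽 (D.iX 𝔽 f) = 0) : f = 0 :=
  D.isHeight.spread_injective D.finX D.finY h

lemma eq_zero_of_pX_iY {f : S.GG ⧸ D.K' →₀ 𝔽} (h : D.pX 𝔽 (D.iY 𝔽 f) = 0) : f = 0 :=
  D.isHeight'.spread_injective D.finY D.finX h

lemma pX_iY_single (g : S.GG) : D.pX 𝔽 (D.iY 𝔽 (Finsupp.single (g : S.GG ⧸ D.K') 1)) =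
    Finsupp.single (g : S.GG ⧸ C.K) 1 +
      ∑ u ∈ D.U1, Finsupp.single ((g * (C.βK * u * S.alphaE⁻¹) : S.GG) : S.GG ⧸ C.K) 1 := by
  rw [iY_single, map_add, map_sum, pX_single]
  simp only [pX_single]

lemma mul_beta_mul_beta (D : TreeData C) (g u w : S.GG) :
    g * (u * C.βK) * (C.βK * w * S.alphaE⁻¹) = g * (u * w * S.alphaE⁻¹) := by
  have h := D.beta_mul_beta
  simp only [mul_assoc]
  rw [← mul_assoc C.βK C.βK, h, one_mul]

/-- The square of the adjacency operator at a vertex. -/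
lemma pX_iY_pY_iX_single (hp : (S.p : 𝔽) = 0) (g : S.GG) :
    D.pX 𝔽 (D.iY 𝔽 (D.pY 𝔽 (D.iX 𝔽 (Finsupp.single (g : S.GG ⧸ C.K) 1)))) =
      Finsupp.single (g : S.GG ⧸ C.K) 1 +
      (∑ u ∈ D.U0 ×ˢ D.U1,
          Finsupp.single ((g * (u.1 * u.2 * S.alphaE⁻¹) : S.GG) : S.GG ⧸ C.K) 1 +
        ∑ u ∈ D.U1,
          Finsupp.single ((g * (C.βK * u * S.alphaE⁻¹) : S.GG) : S.GG ⧸ C.K) 1) := by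
  rw [iX_single, map_add, map_sum, pY_single]
  simp only [pY_single]
  rw [map_add, map_add, map_sum, map_sum, pX_iY_single]
  simp only [pX_iY_single, D.mul_beta_mul_beta]
  rw [Finset.sum_add_distrib, Finset.sum_product]
  have h : ∑ u ∈ D.U0, Finsupp.single ((g * (u * C.βK) : S.GG) : S.GG ⧸ C.K) (1 : 𝔽) = 0 := by
    rw [Finset.sum_congr rfl fun u hu => by
      rw [QuotientGroup.mk_mul_of_mem _ (D.isStarReps_K.1 u hu).1], Finset.sum_const,
      ← Nat.cast_smul_eq_nsmul 𝔽, D.card_U0 hp, zero_smul]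
  rw [h, zero_add, add_assoc]
  exact congrArg _ (add_comm _ _)

variable (𝔽) in
/-- Summation over the other edges at the vertex of type `K`. -/
def oppX : (S.GG ⧸ D.I →₀ 𝔽) →ₗ[𝔽] (S.GG ⧸ D.I →₀ 𝔽) := D.iX 𝔽 ∘ₗ D.pX 𝔽 - LinearMap.id

variable (𝔽) in
/-- Summation over the other edges at the vertex of type `K'`. -/
def oppY : (S.GG ⧸ D.I →₀ 𝔽) →ₗ[𝔽] (S.GG ⧸ D.I →₀ 𝔽) := D.iY 𝔽 ∘ₗ D.pY 𝔽 - LinearMap.id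

lemma oppX_apply (c : S.GG ⧸ D.I →₀ 𝔽) : D.oppX 𝔽 c = D.iX 𝔽 (D.pX 𝔽 c) - c := rfl

lemma oppY_apply (c : S.GG ⧸ D.I →₀ 𝔽) : D.oppY 𝔽 c = D.iY 𝔽 (D.pY 𝔽 c) - c := rfl

lemma pX_oppX (hp : (S.p : 𝔽) = 0) (c : S.GG ⧸ D.I →₀ 𝔽) : D.pX 𝔽 (D.oppX 𝔽 c) = 0 := by
  rw [oppX_apply, map_sub, D.pX_iX hp, sub_self]

lemma pY_oppY (hp : (S.p : 𝔽) = 0) (c : S.GG ⧸ D.I →₀ 𝔽) : D.pY 𝔽 (D.oppY 𝔽 c) = 0 := by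
  rw [oppY_apply, map_sub, D.pY_iY hp, sub_self]

lemma oppY_oppX_single (g : S.GG) :
    D.oppY 𝔽 (D.oppX 𝔽 (Finsupp.single (g : S.GG ⧸ D.I) 1)) = ∑ u ∈ D.U0 ×ˢ D.U1,
      Finsupp.single ((g * (u.1 * u.2 * S.alphaE⁻¹) : S.GG) : S.GG ⧸ D.I) 1 := by
  have hY : ∀ h : S.GG, D.oppY 𝔽 (Finsupp.single (h : S.GG ⧸ D.I) 1) = ∑ u ∈ D.U1,
      Finsupp.single ((h * (C.βK * u * S.alphaE⁻¹) : S.GG) : S.GG ⧸ D.I) 1 := by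
    intro h
    rw [oppY_apply, pY_single, iY_single, add_sub_cancel_left]
  rw [oppX_apply, pX_single, iX_single, add_sub_cancel_left, map_sum, Finset.sum_product]
  simp only [hY, D.mul_beta_mul_beta]

end TreeData
end U21

namespace U21
namespace TreeData

variable {S : Setting} {C : Chamber S} (D : TreeData C) {𝔽 : Type} [Field 𝔽]
variable {W : Type} [AddCommGroup W] [Module 𝔽 W] {σ : Representation 𝔽 ↥C.K W}

lemma heckeT_std {jσ : W →ₗ[𝔽] W} {T : Module.End 𝔽 (IndSub C 𝔽 W σ)}
    (hT : IsHeckeT C 𝔽 W σ jσ T) (g : S.GG) (v : W) :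
    T (std σ g v) = ∑ u ∈ D.U0 ×ˢ D.U1, std σ (g * (u.1 * u.2 * S.alphaE⁻¹))
        (jσ (sigma' C 𝔽 W σ (u.1 * u.2)⁻¹ v)) +
      ∑ u ∈ D.U1, std σ (g * (C.βK * u * S.alphaE⁻¹)) (jσ (sigma' C 𝔽 W σ C.βK v)) := by
  have h1 : T (std σ 1 v) = ∑ u ∈ D.U0 ×ˢ D.U1, std σ (u.1 * u.2 * S.alphaE⁻¹)
        (jσ (sigma' C 𝔽 W σ (u.1 * u.2)⁻¹ v)) +
      ∑ u ∈ D.U1, std σ (C.βK * u * S.alphaE⁻¹) (jσ (sigma' C 𝔽 W σ C.βK v)) := by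
    apply Subtype.ext
    rw [hT.2 v (std σ 1 v) rfl _ _ D.isReps_mul D.isReps_U1, Finset.sum_image D.injOn_mul,
      Submodule.coe_add, Submodule.coe_sum, Submodule.coe_sum]
    rfl
  rw [← mul_one g, ← indRep_std, hT.1, h1, map_add, map_sum, map_sum]
  simp only [indRep_std, mul_one]

section Trivial

variable (C 𝔽) in
/-- The identification of the functions on the vertices `G/K` with `ind_K^G 1`. -/
def vertexMap : (S.GG ⧸ C.K →₀ 𝔽) →ₗ[𝔽] IndSub C 𝔽 𝔽 (1 : Representation 𝔽 ↥C.K 𝔽) :=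
  cosetMap (v₀ := 1) 1 le_rfl fun j hj => by rw [sigma'_of_mem _ hj]; rfl

lemma vertexMap_apply (c : S.GG ⧸ C.K →₀ 𝔽) (g : S.GG) :
    (vertexMap C 𝔽 c : S.GG → 𝔽) g = c ((g⁻¹ : S.GG) : S.GG ⧸ C.K) := by
  induction c using Finsupp.induction_linear with
  | zero => rw [map_zero]; rfl
  | add c d hc hd => rw [map_add, Finsupp.add_apply, ← hc, ← hd]; rfl
  | single x r =>
    induction x using QuotientGroup.induction_on with
    | H h =>
    rw [vertexMap, cosetMap_single]
    change r • (std (1 : Representation 𝔽 ↥C.K 𝔽) h 1 : S.GG → 𝔽) g = _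
    rw [std_apply, Finsupp.single_apply, smul_eq_mul]
    have e : (h : S.GG ⧸ C.K) = ((g⁻¹ : S.GG) : S.GG ⧸ C.K) ↔ g * h ∈ C.K := by
      rw [eq_comm, QuotientGroup.eq, inv_inv]
    by_cases hK : g * h ∈ C.K
    · rw [if_pos hK, if_pos (e.mpr hK), sigma'_of_mem _ hK]
      exact mul_one r
    · rw [if_neg hK, if_neg (mt e.mp hK), mul_zero]

lemma vertexMap_injective : Function.Injective (vertexMap C 𝔽) := by
  intro c d h
  ext x
  induction x using QuotientGroup.induction_on with
  | H g => rw [← inv_inv g, ← vertexMap_apply, ← vertexMap_apply, h]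

lemma vertexMap_surjective : Function.Surjective (vertexMap C 𝔽) := by
  rw [← LinearMap.range_eq_top]
  refine eq_top_of_std_mem _ fun g r => ⟨Finsupp.single (g : S.GG ⧸ C.K) r, ?_⟩
  rw [vertexMap, cosetMap_single]
  refine ((stdHom _ g).map_smul r 1).symm.trans ?_
  rw [smul_eq_mul, mul_one]
  rfl

lemma heckeT_add_one_vertexMap (hp : (S.p : 𝔽) = 0)
    {T : Module.End 𝔽 (IndSub C 𝔽 𝔽 (1 : Representation 𝔽 ↥C.K 𝔽))}
    (hT : IsHeckeT C 𝔽 𝔽 (1 : Representation 𝔽 ↥C.K 𝔽) LinearMap.id T)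
    (c : S.GG ⧸ C.K →₀ 𝔽) : (T + 1) (vertexMap C 𝔽 c) =
      vertexMap C 𝔽 (D.pX 𝔽 (D.iY 𝔽 (D.pY 𝔽 (D.iX 𝔽 c)))) := by
  suffices (T + 1) ∘ₗ vertexMap C 𝔽 =
      vertexMap C 𝔽 ∘ₗ D.pX 𝔽 ∘ₗ D.iY 𝔽 ∘ₗ D.pY 𝔽 ∘ₗ D.iX 𝔽 from LinearMap.congr_fun this c
  have hs : ∀ g : S.GG, vertexMap C 𝔽 (Finsupp.single (g : S.GG ⧸ C.K) 1) = std 1 g 1 :=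
    fun g => (cosetMap_single _ _ g 1).trans (one_smul _ _)
  have hone : ∀ g ∈ C.K, sigma' C 𝔽 𝔽 (1 : Representation 𝔽 ↥C.K 𝔽) g = 1 := by
    intro g hg
    rw [sigma'_of_mem _ hg]
    rfl
  refine Finsupp.lhom_ext' fun x => LinearMap.ext_ring ?_
  induction x using QuotientGroup.induction_on with
  | H g =>
  simp only [LinearMap.comp_apply, Finsupp.lsingle_apply]
  rw [D.pX_iY_pY_iX_single hp, map_add, map_add, map_sum, map_sum, LinearMap.add_apply]
  simp only [hs]
  rw [D.heckeT_std hT, hone _ D.beta_mem, add_comm]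
  refine congrArg₂ _ rfl (congrArg₂ _ (Finset.sum_congr rfl fun u hu => ?_) rfl)
  obtain ⟨h0, h1⟩ := Finset.mem_product.mp hu
  rw [hone _ (inv_mem (mul_mem (D.U0_subset h0).1 (D.U1_subset h1).1))]
  rfl

lemma not_quotientIrreducible_trivial (D : TreeData C) (hp : (S.p : 𝔽) = 0)
    {T : Module.End 𝔽 (IndSub C 𝔽 𝔽 (1 : Representation 𝔽 ↥C.K 𝔽))}
    (hT : IsHeckeT C 𝔽 𝔽 (1 : Representation 𝔽 ↥C.K 𝔽) LinearMap.id T) :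
    ¬ QuotientIrreducible 𝔽 (indRep C 𝔽 𝔽 (1 : Representation 𝔽 ↥C.K 𝔽))
      (LinearMap.range (T + 1)) := by
  refine not_quotientIrreducible
    (P := LinearMap.range (vertexMap C 𝔽 ∘ₗ D.pX 𝔽 ∘ₗ D.iY 𝔽)) ?_ ?_ (fun heq => ?_) (fun htop => ?_)
  · rintro g - ⟨f, rfl⟩
    refine ⟨f.mapDomain (g • ·), ?_⟩
    simp only [LinearMap.comp_apply]
    rw [vertexMap, indRep_cosetMap, iY, D.isStarReps_K'.pull_smul, pX, Finsupp.lmapDomain_apply,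
      mapDomain_quotientMapOfLE_smul]
    rfl
  · rintro - ⟨x, rfl⟩
    obtain ⟨c, rfl⟩ := vertexMap_surjective x
    exact ⟨_, (D.heckeT_add_one_vertexMap hp hT c).symm⟩
  · have hmem : vertexMap C 𝔽 (D.pX 𝔽 (D.iY 𝔽 (Finsupp.single ((1 : S.GG) : S.GG ⧸ D.K') 1))) ∈
        LinearMap.range (T + 1) := heq ▸ ⟨_, rfl⟩
    obtain ⟨x, hx⟩ := hmem
    obtain ⟨c, rfl⟩ := vertexMap_surjective x
    rw [D.heckeT_add_one_vertexMap hp hT] at hx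
    have h0 := sub_eq_zero.mpr (vertexMap_injective hx)
    rw [← map_sub, ← map_sub] at h0
    exact D.pY_iX_ne_single _ _ (sub_eq_zero.mp (D.eq_zero_of_pX_iY h0))
  · have hmem : vertexMap C 𝔽 (Finsupp.single ((1 : S.GG) : S.GG ⧸ C.K) 1) ∈
        LinearMap.range (vertexMap C 𝔽 ∘ₗ D.pX 𝔽 ∘ₗ D.iY 𝔽) := htop ▸ Submodule.mem_top
    obtain ⟨f, hf⟩ := hmem
    exact D.pX_iY_ne_single _ _ (vertexMap_injective hf)

end Trivial

section Steinberg

/-- The translates of the indicator function of the Iwahori subgroup, in the finite principal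
series. -/
def translate (D : TreeData C) (𝔽 : Type) [Field 𝔽] (κ : C.K) : PS1sub C 𝔽 :=
  ⟨fun k => if (k : S.GG) * κ ∈ D.I then 1 else 0, by
    refine ⟨fun b hb x => ?_, fun h hh x => ?_, fun z hz x => ?_⟩
    · have hb' : (b : S.GG) ∈ D.I := D.I1_le hb
      simp only [Subgroup.coe_mul, mul_assoc, mul_mem_cancel_left hb']
    · have hh' : (h : S.GG) ∈ D.I := D.H0_le hh
      simp only [Subgroup.coe_mul, mul_assoc, mul_mem_cancel_left hh', one_mul]
    · have hz' := D.Kone_conj_mem x x.2 z hz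
      have e : ((x * z : C.K) : S.GG) * κ = (x * z * (x : S.GG)⁻¹) * (x * κ) := by
        simp [mul_assoc]
      simp only [e, mul_mem_cancel_left hz']⟩

lemma translate_apply (κ k : C.K) :
    (D.translate 𝔽 κ : C.K → 𝔽) k = if (k : S.GG) * κ ∈ D.I then 1 else 0 := rfl

variable (σ) in
/-- `φ` exhibits `σ` as the quotient of the finite principal series by the constants. -/
def IsSteinbergMap (φ : PS1sub C 𝔽 →ₗ[𝔽] W) : Prop :=
  Function.Surjective φ ∧
  (∀ f : PS1sub C 𝔽, φ f = 0 ↔ ∃ c : 𝔽, (f : C.K → 𝔽) = fun _ => c) ∧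
  ∀ (k : C.K) (f f' : PS1sub C 𝔽),
    (f' : C.K → 𝔽) = PSact C 𝔽 k (f : C.K → 𝔽) → φ f' = σ k (φ f)

variable {φ : PS1sub C 𝔽 →ₗ[𝔽] W}

lemma sigma'_map_translate (hφ : IsSteinbergMap σ φ) {κ : S.GG} (hκ : κ ∈ C.K) :
    sigma' C 𝔽 W σ κ (φ (D.translate 𝔽 1)) = φ (D.translate 𝔽 ⟨κ, hκ⟩) := by
  rw [sigma'_of_mem σ hκ]
  refine (hφ.2.2 _ _ _ (funext fun k => ?_)).symm
  simp [PSact, translate_apply]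

lemma sigma'_fixed (hφ : IsSteinbergMap σ φ) :
    ∀ i ∈ D.I, sigma' C 𝔽 W σ i (φ (D.translate 𝔽 1)) = φ (D.translate 𝔽 1) := by
  intro i hi
  rw [D.sigma'_map_translate hφ hi.1]
  congr 1
  ext k
  simp only [translate_apply, mul_mem_cancel_right hi, Subgroup.coe_one, mul_one]

lemma map_translate_ne_zero (hφ : IsSteinbergMap σ φ) : φ (D.translate 𝔽 1) ≠ 0 := by
  intro h
  obtain ⟨c, hc⟩ := (hφ.2.1 _).mp h
  have h1 := congrFun hc 1
  have h2 := congrFun hc ⟨C.βK, D.beta_mem⟩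
  have hβ : C.βK ∉ D.I := fun h => D.beta_not_mem h.2
  rw [translate_apply] at h1 h2
  simp only [Subgroup.coe_one, mul_one, one_mem, if_true, if_neg hβ] at h1 h2
  exact one_ne_zero (h1.trans h2.symm)

/-- The map from functions on edges to `ind_K^G st`. -/
def edgeMap (hφ : IsSteinbergMap σ φ) : (S.GG ⧸ D.I →₀ 𝔽) →ₗ[𝔽] IndSub C 𝔽 W σ :=
  cosetMap σ inf_le_left (D.sigma'_fixed hφ)

lemma edgeMap_single (hφ : IsSteinbergMap σ φ) (g : S.GG) :
    D.edgeMap hφ (Finsupp.single (g : S.GG ⧸ D.I) 1) = std σ g (φ (D.translate 𝔽 1)) :=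
  (cosetMap_single _ _ g 1).trans (one_smul _ _)

/-- The value of `edgeMap c` at `g` is the image of the restriction of `c` to the star of the
vertex `g⁻¹K`. -/
lemma edgeMap_apply (hφ : IsSteinbergMap σ φ) (c : S.GG ⧸ D.I →₀ 𝔽) (g : S.GG) :
    ∃ f : PS1sub C 𝔽,
      (∀ k : C.K, (f : C.K → 𝔽) k = c ((((k : S.GG) * g)⁻¹ : S.GG) : S.GG ⧸ D.I)) ∧
      (D.edgeMap hφ c : S.GG → W) g = φ f := by
  induction c using Finsupp.induction_linear with
  | zero => exact ⟨0, fun k => rfl, by rw [map_zero, map_zero]; rfl⟩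
  | add c d hc hd =>
    obtain ⟨f₁, h₁, e₁⟩ := hc
    obtain ⟨f₂, h₂, e₂⟩ := hd
    refine ⟨f₁ + f₂, fun k => ?_, ?_⟩
    · rw [Finsupp.add_apply, ← h₁, ← h₂]
      rfl
    · rw [map_add, map_add, ← e₁, ← e₂]
      rfl
  | single e r =>
    induction e using QuotientGroup.induction_on with
    | H h =>
    have hval : (D.edgeMap hφ (Finsupp.single (h : S.GG ⧸ D.I) r) : S.GG → W) g =
        r • (std σ h (φ (D.translate 𝔽 1)) : S.GG → W) g := by
      rw [edgeMap, cosetMap_single]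
      rfl
    have heq : ∀ k : S.GG, (h : S.GG ⧸ D.I) = (((k * g)⁻¹ : S.GG) : S.GG ⧸ D.I) ↔
        k * (g * h) ∈ D.I := by
      intro k
      rw [eq_comm, QuotientGroup.eq, inv_inv, mul_assoc]
    rw [hval, std_apply]
    by_cases hK : g * h ∈ C.K
    · refine ⟨r • D.translate 𝔽 ⟨g * h, hK⟩, fun k => ?_, ?_⟩
      · rw [Finsupp.single_apply, if_congr (heq k) rfl rfl]
        change r • (D.translate 𝔽 ⟨g * h, hK⟩ : C.K → 𝔽) k = _
        rw [translate_apply, smul_eq_mul, mul_ite, mul_one, mul_zero]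
      · rw [if_pos hK, D.sigma'_map_translate hφ hK, map_smul]
    · refine ⟨0, fun k => ?_, ?_⟩
      · rw [Finsupp.single_apply, if_neg]
        · rfl
        · rw [heq]
          exact fun hI => hK ((mul_mem_cancel_left k.2).mp hI.1)
      · rw [if_neg hK, smul_zero, map_zero]

lemma edgeMap_iX (hφ : IsSteinbergMap σ φ) (f : S.GG ⧸ C.K →₀ 𝔽) :
    D.edgeMap hφ (D.iX 𝔽 f) = 0 := by
  ext g
  obtain ⟨f', h, e⟩ := D.edgeMap_apply hφ (D.iX 𝔽 f) g
  rw [e]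
  refine (hφ.2.1 f').mpr ⟨f ((g⁻¹ : S.GG) : S.GG ⧸ C.K), funext fun k => ?_⟩
  rw [h, pull_apply]
  change f (((k * g)⁻¹ : S.GG) : S.GG ⧸ C.K) = _
  rw [mul_inv_rev, QuotientGroup.mk_mul_of_mem _ (inv_mem k.2)]

lemma eq_iX_of_edgeMap_eq_zero (hp : (S.p : 𝔽) = 0) (hφ : IsSteinbergMap σ φ)
    {c : S.GG ⧸ D.I →₀ 𝔽} (hc : D.edgeMap hφ c = 0) : c = D.iX 𝔽 (D.pX 𝔽 c) := by
  refine (pull_push_of_const D.finX (D.pX_iX hp) fun e e' he => ?_).symm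
  induction e using QuotientGroup.induction_on with
  | H h =>
  induction e' using QuotientGroup.induction_on with
  | H h' =>
  have hk : h'⁻¹ * h ∈ C.K := QuotientGroup.eq.mp he.symm
  obtain ⟨f, hf, e⟩ := D.edgeMap_apply hφ c h⁻¹
  rw [hc] at e
  obtain ⟨d, hd⟩ := (hφ.2.1 f).mp e.symm
  have h1 := hf 1
  have h2 := hf ⟨_, hk⟩
  rw [hd] at h1 h2
  simp only [Subgroup.coe_one, one_mul, inv_inv, mul_inv_rev, mul_inv_cancel_left] at h1 h2
  exact h1.symm.trans h2

lemma edgeMap_surjective (hφ : IsSteinbergMap σ φ) (hσ : IsWeight C 𝔽 W σ) :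
    Function.Surjective (D.edgeMap hφ) := by
  let P : Submodule 𝔽 W := ⨅ g, (LinearMap.range (D.edgeMap hφ)).comap (stdHom σ g)
  have hP : ∀ w, w ∈ P ↔ ∀ g, std σ g w ∈ LinearMap.range (D.edgeMap hφ) := fun w => by
    simp only [P, Submodule.mem_iInf, Submodule.mem_comap]
    rfl
  have hv : φ (D.translate 𝔽 1) ∈ P := (hP _).mpr fun g => ⟨_, D.edgeMap_single hφ g⟩
  rcases hσ.2.2.1 P fun k w hw => (hP _).mpr fun g => by
    have := (hP w).mp hw (g * k)
    rwa [std_mul σ g k.2, sigma'_of_mem σ k.2] at this with h | h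
  · rw [h, Submodule.mem_bot] at hv
    exact absurd hv (D.map_translate_ne_zero hφ)
  · rw [← LinearMap.range_eq_top]
    exact eq_top_of_std_mem σ fun g w => (hP w).mp (h ▸ Submodule.mem_top) g

variable {jσ : W →ₗ[𝔽] W}

lemma j_fixed (hφ : IsSteinbergMap σ φ) (hj : IsJ C 𝔽 W σ jσ) :
    jσ (φ (D.translate 𝔽 1)) = φ (D.translate 𝔽 1) :=
  hj.1 _ fun g hg => D.sigma'_fixed hφ g (D.I1_le hg)

lemma j_beta (hp : (S.p : 𝔽) = 0) (hφ : IsSteinbergMap σ φ) (hj : IsJ C 𝔽 W σ jσ) :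
    jσ (sigma' C 𝔽 W σ C.βK (φ (D.translate 𝔽 1))) = 0 := by
  have h0 := D.edgeMap_iX hφ (Finsupp.single ((1 : S.GG) : S.GG ⧸ C.K) 1)
  rw [iX_single, map_add, map_sum] at h0
  simp only [edgeMap_single] at h0
  have h1 := congrArg (fun f : IndSub C 𝔽 W σ => (f : S.GG → W) C.βK) h0
  simp only [Submodule.coe_add, Submodule.coe_sum, Pi.add_apply, Finset.sum_apply, std_apply,
    mul_one, one_mul, if_pos D.beta_mem] at h1
  have h2 := congrArg jσ h1
  rw [map_add, map_sum] at h2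
  have h3 : ∀ u ∈ D.U0, jσ (if C.βK * (u * C.βK) ∈ C.K then
      sigma' C 𝔽 W σ (C.βK * (u * C.βK)) (φ (D.translate 𝔽 1)) else 0) =
        φ (D.translate 𝔽 1) := by
    intro u hu
    have hK := mul_mem D.beta_mem (D.isStarReps_K.1 u hu).1
    have h4 := hj.2 (φ (D.translate 𝔽 1)) _ (D.beta_conj_mem u hu)
    rw [map_sub, sub_eq_zero] at h4
    rw [if_pos hK, ← mul_assoc, h4, D.j_fixed hφ hj]
  rw [Finset.sum_congr rfl h3, Finset.sum_const, ← Nat.cast_smul_eq_nsmul 𝔽,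
    D.card_U0 hp, zero_smul, add_zero] at h2
  exact h2.trans (map_zero _)

lemma heckeT_edgeMap (hp : (S.p : 𝔽) = 0) (hφ : IsSteinbergMap σ φ) (hj : IsJ C 𝔽 W σ jσ)
    {T : Module.End 𝔽 (IndSub C 𝔽 W σ)} (hT : IsHeckeT C 𝔽 W σ jσ T) (c : S.GG ⧸ D.I →₀ 𝔽) :
    T (D.edgeMap hφ c) = D.edgeMap hφ (D.oppY 𝔽 (D.oppX 𝔽 c)) := by
  suffices T ∘ₗ D.edgeMap hφ = D.edgeMap hφ ∘ₗ D.oppY 𝔽 ∘ₗ D.oppX 𝔽 from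
    LinearMap.congr_fun this c
  refine Finsupp.lhom_ext' fun x => LinearMap.ext_ring ?_
  induction x using QuotientGroup.induction_on with
  | H g =>
  rw [LinearMap.comp_apply, LinearMap.comp_apply, LinearMap.comp_apply, LinearMap.comp_apply,
    LinearMap.comp_apply, Finsupp.lsingle_apply, D.oppY_oppX_single, map_sum, D.edgeMap_single,
    D.heckeT_std hT, D.j_beta hp hφ hj]
  have hz : ∀ h : S.GG, std σ h 0 = 0 := fun h => (stdHom σ h).map_zero
  simp only [hz, Finset.sum_const_zero, add_zero]
  refine Finset.sum_congr rfl fun u hu => ?_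
  obtain ⟨h0, h1⟩ := Finset.mem_product.mp hu
  rw [D.sigma'_fixed hφ _ (inv_mem (mul_mem (D.U0_subset h0) (D.U1_subset h1))),
    D.j_fixed hφ hj, D.edgeMap_single]

lemma not_quotientIrreducible_steinberg (D : TreeData C) (hp : (S.p : 𝔽) = 0)
    (hφ : IsSteinbergMap σ φ) (hσ : IsWeight C 𝔽 W σ) (hj : IsJ C 𝔽 W σ jσ)
    {T : Module.End 𝔽 (IndSub C 𝔽 W σ)} (hT : IsHeckeT C 𝔽 W σ jσ T) :
    ¬ QuotientIrreducible 𝔽 (indRep C 𝔽 W σ) (LinearMap.range T) := by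
  have hX : ∀ c, D.pY 𝔽 c = 0 → D.edgeMap hφ c = 0 → c = 0 := fun c hc h0 => by
    have h1 := D.eq_iX_of_edgeMap_eq_zero hp hφ h0
    rw [h1] at hc
    rw [h1, D.eq_zero_of_pY_iX hc, map_zero]
  refine not_quotientIrreducible (P := (LinearMap.ker (D.pY 𝔽)).map (D.edgeMap hφ))
    ?_ ?_ (fun heq => ?_) (fun htop => ?_)
  · rintro g - ⟨c, hc, rfl⟩
    refine ⟨c.mapDomain (g • ·), ?_, (indRep_cosetMap _ _ g c).symm⟩
    have hc' : Finsupp.mapDomain D.qY c = 0 := hc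
    change Finsupp.mapDomain _ _ = 0
    rw [mapDomain_quotientMapOfLE_smul, hc', Finsupp.mapDomain_zero]
  · rintro - ⟨x, rfl⟩
    obtain ⟨c, rfl⟩ := D.edgeMap_surjective hφ hσ x
    exact ⟨_, D.pY_oppY hp _, (D.heckeT_edgeMap hp hφ hj hT c).symm⟩
  · have hmem : D.edgeMap hφ (D.oppY 𝔽
        (Finsupp.single ((1 : S.GG) : S.GG ⧸ D.I) 1)) ∈ LinearMap.range T :=
      heq ▸ ⟨_, D.pY_oppY hp _, rfl⟩
    obtain ⟨x, hx⟩ := hmem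
    obtain ⟨c, rfl⟩ := D.edgeMap_surjective hφ hσ x
    rw [D.heckeT_edgeMap hp hφ hj hT, eq_comm, ← sub_eq_zero, ← map_sub, ← map_sub] at hx
    have h1 := hX _ (D.pY_oppY hp _) hx
    rw [oppY_apply, sub_eq_zero] at h1
    have h2 := congrArg (D.pX 𝔽) h1
    rw [map_sub (D.pX 𝔽), D.pX_oppX hp, sub_zero, pX_single] at h2
    exact D.pX_iY_ne_single _ _ h2
  · have hmem : D.edgeMap hφ (Finsupp.single ((1 : S.GG) : S.GG ⧸ D.I) 1) ∈
        (LinearMap.ker (D.pY 𝔽)).map (D.edgeMap hφ) := htop ▸ Submodule.mem_top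
    obtain ⟨c, hc, h⟩ := hmem
    rw [eq_comm, ← sub_eq_zero, ← map_sub] at h
    have h1 := congrArg (D.pY 𝔽) (D.eq_iX_of_edgeMap_eq_zero hp hφ h)
    have hc' : D.pY 𝔽 c = 0 := hc
    rw [map_sub (D.pY 𝔽), hc', sub_zero, pY_single] at h1
    exact D.pY_iX_ne_single _ _ h1.symm

end Steinberg
end TreeData
end U21

namespace U21

/-- For `K` either of `K₀, K₁`, both `(ind_K^G st)/(T)` and
`(ind_K^G 1)/(T+1)` are not irreducible. -/
theorem stmt1
    (S : Setting) (C : Chamber S)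
    (𝔽 : Type) [Field 𝔽] [IsAlgClosed 𝔽] [Algebra (ZMod S.p) 𝔽]
    [Algebra.IsAlgebraic (ZMod S.p) 𝔽]
    (Wst : Type) [AddCommGroup Wst] [Module 𝔽 Wst]
    (σst : Representation 𝔽 ↥C.K Wst)
    (hstweight : IsWeight C 𝔽 Wst σst) (hst : IsSteinberg C 𝔽 σst)
    (jst : Wst →ₗ[𝔽] Wst) (hjst : IsJ C 𝔽 Wst σst jst)
    (Tst : Module.End 𝔽 ↥(IndSub C 𝔽 Wst σst)) (hTst : IsHeckeT C 𝔽 Wst σst jst Tst)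
    (Ttr : Module.End 𝔽 ↥(IndSub C 𝔽 𝔽 (1 : Representation 𝔽 ↥C.K 𝔽)))
    (hTtr : IsHeckeT C 𝔽 𝔽 (1 : Representation 𝔽 ↥C.K 𝔽) LinearMap.id Ttr) :
    ¬ QuotientIrreducible 𝔽 (indRep C 𝔽 Wst σst) (LinearMap.range Tst) ∧
    ¬ QuotientIrreducible 𝔽 (indRep C 𝔽 𝔽 (1 : Representation 𝔽 ↥C.K 𝔽))
        (LinearMap.range (Ttr + 1)) := by
  obtain ⟨D⟩ := C.exists_treeData
  have hp : (S.p : 𝔽) = 0 := by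
    rw [← map_natCast (algebraMap (ZMod S.p) 𝔽), ZMod.natCast_self, map_zero]
  obtain ⟨φ, hφ⟩ := hst
  exact ⟨D.not_quotientIrreducible_steinberg hp hφ hstweight hjst hTst,
    D.not_quotientIrreducible_trivial hp hTtr⟩

end U21
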